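/- arXiv:0901.2543 — 6 statements merged into one kernel-verified Lean document; each statement's English description precedes it below -/
import Mathlib

section
/- Let k ≥ 2 and let F_k be the free group on k generators. There exists a constant C > 0 such that for every nontrivial element g ∈ F_k there is a subgroup H of F_k with g ∉ H and with finite index satisfying 0 < [F_k : H] ≤ C·|g|, where |g| denotes the word length of g. -/
/-- Left multiplication by `x` on a group, restricted to the points of a finite set `S` that it
keeps in `S`, extends to a permutation of `S`. -/
theorem exists_perm_extending_mul_left {G : Type*} [Group G] (S : Finset G) (x : G) :
    ∃ σ : Equiv.Perm S, ∀ s : S, x * (s : G) ∈ S → (σ s : G) = x * s := by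
  classical
  let f : S → S := fun s => if h : x * (s : G) ∈ S then ⟨x * s, h⟩ else s
  let T : Finset S := Finset.univ.filter fun s => x * (s : G) ∈ S
  have hf : ∀ s : S, x * (s : G) ∈ S → (f s : G) = x * s := fun s hs => by simp [f, hs]
  have hinj : Set.InjOn f T := by
    intro s hs t ht hst
    have hs' : x * (s : G) ∈ S := by simpa [T] using hs
    have ht' : x * (t : G) ∈ S := by simpa [T] using ht
    have h := congrArg Subtype.val hst
    rw [hf s hs', hf t ht'] at h
    exact Subtype.ext (mul_left_cancel h)
  obtain ⟨g, hg⟩ := Finset.exists_equiv_extend_of_card_eq (t := (Finset.univ : Finset S))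
    (by simp) (Finset.subset_univ (T.image f)) hinj
  refine ⟨g.trans (Equiv.subtypeUnivEquiv Finset.mem_univ), fun s hs => ?_⟩
  have h : ((g s : S) : G) = f s := congrArg Subtype.val (hg s (by simp [T, hs]))
  exact h.trans (hf s hs)

/-- If the permutations `σ a` of `S` extend the partial left multiplications by the generators, and
`S` contains the classes of all suffixes of `L`, then `L` moves `1` to its own class. -/
theorem FreeGroup.lift_mk_apply_one_of_suffixes {α : Type*} (S : Finset (FreeGroup α))
    (σ : α → Equiv.Perm S)
    (hσ : ∀ a, ∀ s : S, FreeGroup.of a * (s : FreeGroup α) ∈ S →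
      (σ a s : FreeGroup α) = FreeGroup.of a * s)
    (h1 : 1 ∈ S) (L : List (α × Bool)) (hL : ∀ M, M <:+ L → FreeGroup.mk M ∈ S) :
    (FreeGroup.lift σ (FreeGroup.mk L) ⟨1, h1⟩ : FreeGroup α) = FreeGroup.mk L := by
  induction L with
  | nil => simp [← FreeGroup.one_eq_mk]
  | cons p L ih =>
    have ih := ih fun M hM => hL M (hM.trans (List.suffix_cons p L))
    have hmem := hL _ (List.suffix_refl (p :: L))
    have hcons : FreeGroup.mk (p :: L) = FreeGroup.mk [p] * FreeGroup.mk L := by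
      simp [FreeGroup.mul_mk]
    rw [hcons] at hmem ⊢
    rw [_root_.map_mul, Equiv.Perm.mul_apply]
    generalize FreeGroup.lift σ (FreeGroup.mk L) ⟨1, h1⟩ = s at ih
    rw [← ih] at hmem ⊢
    obtain ⟨a, b⟩ := p
    cases b with
    | true => simpa [FreeGroup.of] using hσ a s hmem
    | false =>
      have hinv : FreeGroup.mk [(a, false)] = (FreeGroup.of a)⁻¹ := by
        simp [FreeGroup.of, FreeGroup.inv_mk, FreeGroup.invRev]
      rw [hinv] at hmem ⊢
      have h : σ a ⟨_, hmem⟩ = s := Subtype.ext <| by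
        rw [hσ a ⟨_, hmem⟩ (by simp)]
        simp
      have h' : (σ a)⁻¹ s = ⟨_, hmem⟩ := by rw [Equiv.Perm.inv_eq_iff_eq, h]
      rw [_root_.map_inv, FreeGroup.lift_apply_of, h']

/-- A nontrivial element of a free group avoids some subgroup of positive index at most one more
than its word length. -/
theorem FreeGroup.exists_subgroup_index_le_norm_add_one {α : Type*} [DecidableEq α]
    (g : FreeGroup α) (hg : g ≠ 1) :
    ∃ H : Subgroup (FreeGroup α), g ∉ H ∧ 0 < H.index ∧ H.index ≤ g.norm + 1 := by
  let S : Finset (FreeGroup α) := (g.toWord.tails.map FreeGroup.mk).toFinset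
  have hS : ∀ M, M <:+ g.toWord → FreeGroup.mk M ∈ S := fun M hM =>
    List.mem_toFinset.2 (List.mem_map_of_mem ((List.mem_tails _ _).2 hM))
  have hcard : S.card ≤ g.norm + 1 := by
    simpa [FreeGroup.norm] using (g.toWord.tails.map FreeGroup.mk).toFinset_card_le
  have h1 : (1 : FreeGroup α) ∈ S := hS [] List.nil_suffix
  choose σ hσ using fun a : α => exists_perm_extending_mul_left S (FreeGroup.of a)
  let _ : MulAction (FreeGroup α) S := MulAction.compHom S (FreeGroup.lift σ)
  refine ⟨MulAction.stabilizer (FreeGroup α) (⟨1, h1⟩ : S), fun hmem => hg ?_, ?_, ?_⟩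
  · have h := FreeGroup.lift_mk_apply_one_of_suffixes S σ hσ h1 g.toWord hS
    rw [FreeGroup.mk_toWord] at h
    exact h.symm.trans (congrArg Subtype.val (MulAction.mem_stabilizer_iff.1 hmem))
  · rw [MulAction.index_stabilizer, Set.ncard_pos]
    exact MulAction.nonempty_orbit _
  · rw [MulAction.index_stabilizer]
    refine (Set.ncard_le_card _).trans ?_
    simpa using hcard


/-- **Linear bound for quantified residual finiteness of free groups.**
For the free group `F_k` (`k ≥ 2`) there is a constant `C > 0` such that every
nontrivial `g` avoids some subgroup of finite index at most `C·|g|`. -/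
theorem exists_subgroup_index_linear_not_mem
    (k : ℕ) (hk : 2 ≤ k) :
    ∃ C : ℝ, 0 < C ∧
      ∀ g : FreeGroup (Fin k), g ≠ 1 →
        ∃ H : Subgroup (FreeGroup (Fin k)),
          g ∉ H ∧ 0 < H.index ∧ (H.index : ℝ) ≤ C * (FreeGroup.norm g : ℝ) := by
  refine ⟨2, two_pos, fun g hg => ?_⟩
  obtain ⟨H, hgH, hpos, hle⟩ := FreeGroup.exists_subgroup_index_le_norm_add_one g hg
  have hnorm : 1 ≤ g.norm := Nat.one_le_iff_ne_zero.2 (mt FreeGroup.norm_eq_zero.1 hg)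
  have h : H.index ≤ 2 * g.norm := by omega
  exact ⟨H, hgH, hpos, by exact_mod_cast h⟩
end

section
/- Let k ≥ 2 and let F_k be the free group on k generators. There exists a natural-number constant C > 0 such that for every nontrivial element g ∈ F_k there is a normal subgroup N of F_k with g ∉ N and with finite index satisfying [F_k : N] ≤ (C·|g|)!, where |g| denotes the word length of g and m! denotes the factorial of m. -/
open Relator in
/-- A one-to-one relation on a finite type is contained in the graph of a permutation. -/
theorem Relator.BiUnique.exists_perm {α : Type*} [Finite α] {R : α → α → Prop}
    (hR : BiUnique R) : ∃ σ : Equiv.Perm α, ∀ x y, R x y → σ x = y := by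
  classical
  have := Fintype.ofFinite α
  let f : α → α := fun x => if h : ∃ y, R x y then h.choose else x
  have hf : ∀ x y, R x y → f x = y := fun x y h => by
    have hx : ∃ y, R x y := ⟨y, h⟩
    simp only [f, dif_pos hx]
    exact hR.2 hx.choose_spec h
  have hinj : Set.InjOn f {x | ∃ y, R x y} := by
    rintro x ⟨y, hy⟩ x' ⟨y', hy'⟩ h
    rw [hf x y hy, hf x' y' hy'] at h
    subst h
    exact hR.1 hy hy'
  obtain ⟨g, hg⟩ := Set.MapsTo.exists_equiv_extend_of_card_eq (t := Finset.univ) (f := f)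
    (by simp) (fun _ _ => by simp) hinj
  refine ⟨g.trans (Equiv.subtypeUnivEquiv Finset.mem_univ), fun x y h => ?_⟩
  simpa [hf x y h] using hg x ⟨y, h⟩

/-- If the `i`-th permutation of a list moves `v (i + 1)` to `v i`, then the product of the list
moves the last vertex to the first. -/
theorem List.prod_map_perm_apply {α β : Type*} (P : β → Equiv.Perm α) (l : List β) (v : ℕ → α)
    (h : ∀ (i : ℕ) (hi : i < l.length), P l[i] (v (i + 1)) = v i) :
    (l.map P).prod (v l.length) = v 0 := by
  induction l generalizing v with
  | nil => simp
  | cons b l ih =>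
    have := ih (fun i => v (i + 1)) fun i hi => h (i + 1) (by simpa using hi)
    simp only [map_cons, prod_cons, length_cons, Equiv.Perm.mul_apply]
    rw [this]
    exact h 0 (by simp)

/-- A reduced word of length `n` is traced along a path through all of `Fin (n + 1)` by some
action of the free group. -/
theorem FreeGroup.exists_perm_apply_last_eq_zero {α : Type*} [DecidableEq α] (g : FreeGroup α) :
    ∃ φ : FreeGroup α →* Equiv.Perm (Fin (g.norm + 1)), φ g (Fin.last g.norm) = 0 := by
  have hred : ∀ (i : ℕ) (a : α) (b : Bool), g.toWord[i]? = some (a, b) →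
      g.toWord[i + 1]? = some (a, !b) → False := by
    intro i a b h₁ h₂
    obtain ⟨hi, h₁⟩ := List.getElem?_eq_some_iff.1 h₁
    obtain ⟨hj, h₂⟩ := List.getElem?_eq_some_iff.1 h₂
    have := List.isChain_iff_getElem.1 (isReduced_toWord (x := g)) i hj
    simp [h₁, h₂] at this
  let R (a : α) (x y : Fin (g.norm + 1)) : Prop :=
    (x.val = y + 1 ∧ g.toWord[y.val]? = some (a, true)) ∨
      (y.val = x + 1 ∧ g.toWord[x.val]? = some (a, false))
  have hR (a : α) : Relator.BiUnique (R a) := by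
    constructor
    · rintro x z y (⟨h₁, h₂⟩ | ⟨h₁, h₂⟩) (⟨h₃, h₄⟩ | ⟨h₃, h₄⟩)
      · exact Fin.ext (by omega)
      · exact (hred z a false h₄ (by rw [← h₃]; exact h₂)).elim
      · exact (hred x a false h₂ (by rw [← h₁]; exact h₄)).elim
      · exact Fin.ext (by omega)
    · rintro x y z (⟨h₁, h₂⟩ | ⟨h₁, h₂⟩) (⟨h₃, h₄⟩ | ⟨h₃, h₄⟩)
      · exact Fin.ext (by omega)
      · exact (hred y a true h₂ (by rw [← h₁]; exact h₄)).elim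
      · exact (hred z a true h₄ (by rw [← h₃]; exact h₂)).elim
      · exact Fin.ext (by omega)
  choose σ hσ using fun a => (hR a).exists_perm
  refine ⟨lift σ, ?_⟩
  have key := List.prod_map_perm_apply (fun x : α × Bool => cond x.2 (σ x.1) (σ x.1)⁻¹) g.toWord
    (Fin.ofNat (g.norm + 1)) fun i hi => by
      have hn : g.toWord.length = g.norm := rfl
      have h₀ : i % (g.norm + 1) = i := Nat.mod_eq_of_lt (by omega)
      have h₁ : (i + 1) % (g.norm + 1) = i + 1 := Nat.mod_eq_of_lt (by omega)
      rcases hw : g.toWord[i] with ⟨a, b⟩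
      have hw' : g.toWord[i]? = some (a, b) := by rw [List.getElem?_eq_getElem hi, hw]
      cases b
      · exact Equiv.Perm.inv_eq_iff_eq.2 (hσ a _ _ (.inr (by simp [h₀, h₁, hw']))).symm
      · exact hσ a _ _ (.inl (by simp [h₀, h₁, hw']))
  have hlast : Fin.ofNat (g.norm + 1) g.toWord.length = Fin.last g.norm :=
    Fin.ext (Nat.mod_eq_of_lt (Nat.lt_succ_self _))
  rw [← lift_mk, mk_toWord, hlast] at key
  exact key


/-- **Factorial bound for normal subgroups avoiding a given element of a free group.**
For the free group `F_k` (`k ≥ 2`) there is a natural number constant `C > 0` such that every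
nontrivial `g` avoids some normal subgroup of finite index at most `(C·|g|)!`. -/
theorem exists_normal_subgroup_index_factorial_not_mem
    (k : ℕ) (hk : 2 ≤ k) :
    ∃ C : ℕ, 0 < C ∧
      ∀ g : FreeGroup (Fin k), g ≠ 1 →
        ∃ N : Subgroup (FreeGroup (Fin k)), N.Normal ∧
          g ∉ N ∧ 0 < N.index ∧ N.index ≤ Nat.factorial (C * FreeGroup.norm g) := by
  refine ⟨2, two_pos, fun g hg => ?_⟩
  have hpos : 0 < g.norm := Nat.pos_of_ne_zero (mt FreeGroup.norm_eq_zero.1 hg)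
  obtain ⟨φ, hφ⟩ := g.exists_perm_apply_last_eq_zero
  refine ⟨φ.ker, inferInstance, fun h => ?_, ?_, ?_⟩
  · rw [MonoidHom.mem_ker.1 h, Equiv.Perm.one_apply] at hφ
    exact hpos.ne' (congrArg Fin.val hφ)
  · rw [Subgroup.index_ker]
    exact Nat.card_pos
  · rw [Subgroup.index_ker]
    calc Nat.card φ.range ≤ Nat.card (Equiv.Perm (Fin (g.norm + 1))) :=
          Subgroup.card_le_card_group _
      _ = (g.norm + 1).factorial := by rw [Nat.card_perm, Nat.card_fin]
      _ ≤ (2 * g.norm).factorial := Nat.factorial_le (by omega)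
end

section
/- Let k ≥ 2 and let F_k be the free group on k generators. For a nontrivial element g ∈ F_k, let m(g) denote the least index of a subgroup of F_k not containing g. Then the limit superior, as N → ∞, of the average of m(g) over all nontrivial elements g of F_k of word length at most N, is at most 3. -/
/-- The least (finite) index of a subgroup of the free group `F_k` not containing `g`.
(`Subgroup.index` is `0` for infinite-index subgroups, so we require `0 < n`.) -/
noncomputable def leastAvoidingIndex (k : ℕ) (g : FreeGroup (Fin k)) : ℕ :=
  sInf {n | 0 < n ∧ ∃ H : Subgroup (FreeGroup (Fin k)), g ∉ H ∧ H.index = n}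

open Finset

/-- A partial injection of a finite type extends to a permutation. -/
theorem exists_perm_extending {X : Type*} [Fintype X] (r : X → X → Prop)
    (hr : ∀ x y y', r x y → r x y' → y = y') (hr' : ∀ x x' y, r x y → r x' y → x = x') :
    ∃ σ : Equiv.Perm X, ∀ x y, r x y → σ x = y := by
  classical
  let f : X → X := fun x => if h : ∃ y, r x y then h.choose else x
  have hf : ∀ x y, r x y → f x = y := by
    intro x y h
    have hx : ∃ y, r x y := ⟨y, h⟩
    simp only [f, dif_pos hx]
    exact hr _ _ _ hx.choose_spec h
  obtain ⟨g, hg⟩ := Finset.exists_equiv_extend_of_card_eq (α := X) (t := Finset.univ)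
    (s := {x | ∃ y, r x y}) (f := f) Finset.card_univ.symm (Finset.subset_univ _) (by
      intro x hx x' hx' h
      simp only [coe_filter, mem_univ, true_and, Set.mem_ofPred_eq] at hx hx'
      obtain ⟨y, hy⟩ := hx
      obtain ⟨y', hy'⟩ := hx'
      rw [hf _ _ hy, hf _ _ hy'] at h
      exact hr' _ _ _ hy (h ▸ hy'))
  refine ⟨g.trans (Equiv.subtypeUnivEquiv Finset.mem_univ), fun x y h => ?_⟩
  rw [← hf x y h]
  exact hg x (by simpa using ⟨y, h⟩)

/-- A nonempty reduced word acts nontrivially in some permutation representation on any finite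
set with more points than the word has letters. -/
theorem exists_hom_perm_ne_one {α : Type*} {w : List (α × Bool)} (hw : FreeGroup.IsReduced w)
    (hne : w ≠ []) {j : ℕ} (hj : w.length + 1 ≤ j) :
    ∃ φ : FreeGroup α →* Equiv.Perm (Fin j), φ (FreeGroup.mk w) ≠ 1 := by
  let r : α → Fin j → Fin j → Prop := fun a x y =>
    ∃ i, (w[i]? = some (a, true) ∧ x.val = i + 1 ∧ y.val = i) ∨
      (w[i]? = some (a, false) ∧ x.val = i ∧ y.val = i + 1)
  have hadj : ∀ i a b c, w[i]? = some (a, b) → w[i + 1]? = some (a, c) → b = c := by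
    intro i a b c h1 h2
    obtain ⟨h1', h1⟩ := List.getElem?_eq_some_iff.1 h1
    obtain ⟨h2', h2⟩ := List.getElem?_eq_some_iff.1 h2
    have := List.isChain_iff_getElem.1 hw i h2'
    rw [h1, h2] at this
    exact this rfl
  have hσ : ∀ a, ∃ σ : Equiv.Perm (Fin j), ∀ x y, r a x y → σ x = y := by
    intro a
    apply exists_perm_extending
    · rintro x y y' ⟨i, ⟨h1, h2, h3⟩ | ⟨h1, h2, h3⟩⟩ ⟨i', ⟨h1', h2', h3'⟩ | ⟨h1', h2', h3'⟩⟩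
      · ext; omega
      · obtain rfl : i' = i + 1 := by omega
        simpa using hadj _ _ _ _ h1 h1'
      · obtain rfl : i = i' + 1 := by omega
        simpa using hadj _ _ _ _ h1' h1
      · ext; omega
    · rintro x x' y ⟨i, ⟨h1, h2, h3⟩ | ⟨h1, h2, h3⟩⟩ ⟨i', ⟨h1', h2', h3'⟩ | ⟨h1', h2', h3'⟩⟩
      · ext; omega
      · obtain rfl : i = i' + 1 := by omega
        simpa using hadj _ _ _ _ h1' h1
      · obtain rfl : i' = i + 1 := by omega
        simpa using hadj _ _ _ _ h1 h1'
      · ext; omega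
  choose σ hσ using hσ
  have key : ∀ l i, w.drop i = l → i ≤ w.length →
      ((FreeGroup.lift σ (FreeGroup.mk l)) ⟨w.length, by omega⟩).val = i := by
    intro l
    induction l with
    | nil =>
      intro i h hi
      have := List.drop_eq_nil_iff.1 h
      rw [← FreeGroup.one_eq_mk, map_one, Equiv.Perm.one_apply]
      exact le_antisymm this hi
    | cons b l ih =>
      intro i h hi
      have hi' : i < w.length := by
        by_contra hcon
        simp [List.drop_eq_nil_iff.2 (not_lt.1 hcon)] at h
      rw [List.drop_eq_getElem_cons hi'] at h
      obtain ⟨hb, hl⟩ := List.cons.inj h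
      have ih := ih (i + 1) hl hi'
      set p := (FreeGroup.lift σ (FreeGroup.mk l)) ⟨w.length, by omega⟩ with hp
      have hb' : w[i]? = some b := by rw [List.getElem?_eq_getElem hi', hb]
      have hcons : FreeGroup.mk (b :: l) = FreeGroup.mk [b] * FreeGroup.mk l := by simp
      rw [hcons, map_mul, Equiv.Perm.mul_apply, ← hp]
      obtain ⟨a, _ | _⟩ := b
      · have : σ a ⟨i, by omega⟩ = p := hσ a _ _ ⟨i, Or.inr ⟨hb', rfl, ih⟩⟩
        simp [← this]
      · have : σ a p = ⟨i, by omega⟩ := hσ a _ _ ⟨i, Or.inl ⟨hb', ih, rfl⟩⟩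
        simp [this]
  refine ⟨FreeGroup.lift σ, fun h => hne ?_⟩
  have := key w 0 rfl (Nat.zero_le _)
  rw [h] at this
  exact List.length_eq_zero_iff.1 this

/-- The elements of a group acting trivially in every permutation representation on `j` points. -/
def permKernel (F : Type*) [Group F] (j : ℕ) : Subgroup F :=
  ⨅ φ : F →* Equiv.Perm (Fin j), φ.ker

theorem mem_permKernel {F : Type*} [Group F] {j : ℕ} {g : F} :
    g ∈ permKernel F j ↔ ∀ φ : F →* Equiv.Perm (Fin j), φ g = 1 := by
  simp [permKernel, Subgroup.mem_iInf, MonoidHom.mem_ker]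

theorem map_eq_one_of_mem_permKernel {F Q : Type*} [Group F] [Group Q] [Fintype Q] {j : ℕ}
    (hj : Fintype.card Q ≤ j) (ψ : F →* Q) {g : F} (hg : g ∈ permKernel F j) : ψ g = 1 := by
  obtain ⟨ι⟩ : Nonempty (Q ↪ Fin j) := Function.Embedding.nonempty_of_card_le (by simpa)
  have h := mem_permKernel.1 hg
    ((Equiv.Perm.viaEmbeddingHom ι).comp ((MulAction.toPermHom Q Q).comp ψ))
  rw [MonoidHom.comp_apply, ← map_one (Equiv.Perm.viaEmbeddingHom ι)] at h
  have h' := Equiv.Perm.viaEmbeddingHom_injective ι h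
  simpa using Equiv.congr_fun h' 1

theorem notMem_permKernel {α : Type*} [DecidableEq α] {g : FreeGroup α} (hg : g ≠ 1) {j : ℕ}
    (hj : g.norm + 1 ≤ j) : g ∉ permKernel (FreeGroup α) j := by
  obtain ⟨φ, hφ⟩ := exists_hom_perm_ne_one (FreeGroup.isReduced_toWord (x := g))
    (by simpa using hg) hj
  rw [FreeGroup.mk_toWord] at hφ
  exact fun h => hφ (mem_permKernel.1 h φ)

theorem mem_permKernel_of_lt {k j : ℕ} {g : FreeGroup (Fin k)}
    (h : j < leastAvoidingIndex k g) : g ∈ permKernel (FreeGroup (Fin k)) j := by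
  rw [mem_permKernel]
  intro φ
  ext1 x
  by_contra hx
  let _ : MulAction (FreeGroup (Fin k)) (Fin j) := MulAction.compHom _ φ
  have hidx := MulAction.index_stabilizer (FreeGroup (Fin k)) x
  have hle : (MulAction.orbit (FreeGroup (Fin k)) x).ncard ≤ j := by
    simpa using Set.ncard_le_ncard (Set.subset_univ (MulAction.orbit (FreeGroup (Fin k)) x))
  have hpos : 0 < (MulAction.orbit (FreeGroup (Fin k)) x).ncard :=
    (Set.ncard_pos (Set.toFinite _)).2 (MulAction.nonempty_orbit x)
  refine absurd (h.trans_le (Nat.sInf_le ⟨hpos, _, ?_, hidx⟩)) hle.not_gt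
  rwa [MulAction.mem_stabilizer_iff]

theorem leastAvoidingIndex_le {k : ℕ} {g : FreeGroup (Fin k)} (hg : g ≠ 1) :
    leastAvoidingIndex k g ≤ g.norm + 1 := by
  by_contra! h
  exact notMem_permKernel hg le_rfl (mem_permKernel_of_lt h)

theorem zmod_map_eq_one_of_mem_permKernel {F : Type*} [Group F] {j m a b : ℕ} [NeZero m]
    [NeZero a] [NeZero b] (hm : m = a * b) (hab : a.Coprime b) (ha : a ≤ j) (hb : b ≤ j)
    (ψ : F →* Multiplicative (ZMod m)) {g : F} (hg : g ∈ permKernel F j) : ψ g = 1 := by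
  have cast_zero : ∀ d : ℕ, NeZero d → d ∣ m → d ≤ j → d ∣ (ψ g).toAdd.val := by
    intro d _ hd hdj
    have := map_eq_one_of_mem_permKernel (Q := Multiplicative (ZMod d)) (by simpa [ZMod.card])
      ((AddMonoidHom.toMultiplicative (ZMod.castHom hd (ZMod d)).toAddMonoidHom).comp ψ) hg
    have h' : ZMod.castHom hd (ZMod d) (ψ g).toAdd = 0 := this
    rw [← ZMod.natCast_zmod_val (ψ g).toAdd, map_natCast] at h'
    exact (ZMod.natCast_eq_zero_iff _ _).1 h'
  have h := hab.mul_dvd_of_dvd_of_dvd (cast_zero a inferInstance ⟨b, hm⟩ ha)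
    (cast_zero b inferInstance ⟨a, by rw [hm, mul_comm]⟩ hb)
  rw [← hm, ← ZMod.natCast_eq_zero_iff, ZMod.natCast_zmod_val] at h
  exact h

/-- The reduced words of length `n` that stay reduced when the letter `c` is put in front. -/
def reducedContinuations {α : Type*} [Fintype α] [DecidableEq α] :
    ℕ → α × Bool → Finset (List (α × Bool))
  | 0, _ => {[]}
  | n + 1, c => ({b | c.1 = b.1 → c.2 = b.2} : Finset (α × Bool)).biUnion fun b =>
      (reducedContinuations n b).image (b :: ·)

/-- The reduced words of length `n + 1`. -/
def reducedWords (α : Type*) [Fintype α] [DecidableEq α] (n : ℕ) : Finset (List (α × Bool)) :=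
  (univ : Finset (α × Bool)).biUnion fun b => (reducedContinuations n b).image (b :: ·)

/-- The number of ways to reach `1` from `s` by right multiplications with `f b₁, …, f bₙ`, where
`b₁, …, bₙ` is a reduced word that stays reduced when the letter `c` is put in front. -/
def reducedWalkCount {α G : Type*} [Fintype α] [DecidableEq α] [Group G] [DecidableEq G]
    (f : α × Bool → G) : ℕ → α × Bool → G → ℕ
  | 0, _, s => if s = 1 then 1 else 0
  | n + 1, c, s => ∑ b, if c.1 = b.1 → c.2 = b.2 then reducedWalkCount f n b (s * f b) else 0

section Words

variable {α : Type*} [Fintype α] [DecidableEq α]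

theorem mem_reducedContinuations {n : ℕ} {c : α × Bool} {w : List (α × Bool)} :
    w ∈ reducedContinuations n c ↔ w.length = n ∧ FreeGroup.IsReduced (c :: w) := by
  induction n generalizing c w with
  | zero => cases w <;> simp [reducedContinuations]
  | succ n ih =>
    cases w with
    | nil => simp [reducedContinuations]
    | cons b w =>
      simp only [reducedContinuations, mem_biUnion, mem_filter, mem_univ, true_and, mem_image,
        List.cons.injEq, FreeGroup.isReduced_cons_cons, List.length_cons, Nat.add_right_cancel_iff]
      constructor
      · rintro ⟨b, hb, w, hw, rfl, rfl⟩
        exact ⟨(ih.1 hw).1, hb, (ih.1 hw).2⟩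
      · rintro ⟨h1, h2, h3⟩
        exact ⟨b, h2, w, ih.2 ⟨h1, h3⟩, rfl, rfl⟩

theorem mem_reducedWords {n : ℕ} {w : List (α × Bool)} :
    w ∈ reducedWords α n ↔ w.length = n + 1 ∧ FreeGroup.IsReduced w := by
  cases w with
  | nil => simp [reducedWords]
  | cons b w =>
    simp only [reducedWords, mem_biUnion, mem_univ, true_and, mem_image, List.cons.injEq,
      List.length_cons, Nat.add_right_cancel_iff]
    constructor
    · rintro ⟨b, w, hw, rfl, rfl⟩
      exact mem_reducedContinuations.1 hw
    · exact fun h => ⟨b, w, mem_reducedContinuations.2 h, rfl, rfl⟩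

theorem card_filter_biUnion_cons {β : Type*} [DecidableEq β] (s : Finset β)
    (T : β → Finset (List β)) (P : List β → Prop) [DecidablePred P] :
    #((s.biUnion fun b => (T b).image (b :: ·)).filter P) =
      ∑ b ∈ s, #((T b).filter fun w => P (b :: w)) := by
  rw [filter_biUnion, card_biUnion]
  · refine sum_congr rfl fun b _ => ?_
    rw [filter_image, card_image_of_injective _ (List.cons_injective)]
  · intro b _ b' _ hbb'
    rw [Function.onFun, disjoint_left]
    simp only [mem_filter, mem_image, not_and, and_imp, forall_exists_index]
    rintro _ w _ rfl _ w' _ h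
    exact absurd (List.cons.inj h).1.symm hbb'

theorem card_allowed_letters (c : α × Bool) :
    #({b | c.1 = b.1 → c.2 = b.2} : Finset (α × Bool)) = 2 * Fintype.card α - 1 := by
  have : ({b | c.1 = b.1 → c.2 = b.2} : Finset (α × Bool)) = univ.erase (c.1, !c.2) := by
    ext ⟨a, b⟩
    obtain ⟨c, d⟩ := c
    simp only [mem_filter, mem_univ, true_and, mem_erase, ne_eq, Prod.mk.injEq, and_true]
    cases b <;> cases d <;> simp [eq_comm]
  rw [this, card_erase_of_mem (mem_univ _), card_univ]
  simp [mul_comm]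

theorem card_reducedContinuations (n : ℕ) (c : α × Bool) :
    #(reducedContinuations n c) = (2 * Fintype.card α - 1) ^ n := by
  induction n generalizing c with
  | zero => simp [reducedContinuations]
  | succ n ih =>
    have := card_filter_biUnion_cons ({b | c.1 = b.1 → c.2 = b.2} : Finset (α × Bool))
      (reducedContinuations n) fun _ => True
    simp only [filter_true, ih, sum_const, smul_eq_mul] at this
    rw [reducedContinuations, this, card_allowed_letters, pow_succ']

theorem card_reducedWords (n : ℕ) :
    #(reducedWords α n) = 2 * Fintype.card α * (2 * Fintype.card α - 1) ^ n := by
  have := card_filter_biUnion_cons (univ : Finset (α × Bool))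
    (reducedContinuations n) fun _ => True
  simp only [filter_true, card_reducedContinuations, sum_const, smul_eq_mul] at this
  rw [reducedWords, this]
  simp [mul_comm]

open Classical in
theorem card_reducedContinuations_filter_le {R : Subgroup (FreeGroup α)} {L M : ℕ}
    (h : ∀ c t, #((reducedContinuations L c).filter fun w => t * FreeGroup.mk w ∈ R) ≤ M)
    (n : ℕ) (c : α × Bool) (t : FreeGroup α) :
    #((reducedContinuations (L + n) c).filter fun w => t * FreeGroup.mk w ∈ R) ≤
      M * (2 * Fintype.card α - 1) ^ n := by
  induction n generalizing c t with
  | zero => simpa using h c t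
  | succ n ih =>
    rw [← add_assoc, reducedContinuations, card_filter_biUnion_cons]
    calc _ ≤ ∑ b ∈ ({b | c.1 = b.1 → c.2 = b.2} : Finset (α × Bool)),
          M * (2 * Fintype.card α - 1) ^ n := by
          refine sum_le_sum fun b _ => ?_
          refine (congrArg card (filter_congr fun w _ => ?_)).trans_le
            (ih b (t * FreeGroup.mk [b]))
          rw [mul_assoc, FreeGroup.mul_mk, List.singleton_append]
      _ = _ := by
          rw [sum_const, card_allowed_letters, smul_eq_mul, pow_succ]
          ring

open Classical in
/-- If at most `M` of the `(2k - 1) ^ L` continuations of length `L` of any letter lie in any given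
left coset of `R`, then the proportion of longer reduced words lying in `R` is at most
`M / (2k - 1) ^ L`. -/
theorem card_reducedWords_filter_mem_le {R : Subgroup (FreeGroup α)} {L M : ℕ}
    (h : ∀ c t, #((reducedContinuations L c).filter fun w => t * FreeGroup.mk w ∈ R) ≤ M)
    {n : ℕ} (hn : L ≤ n) :
    #((reducedWords α n).filter fun w => FreeGroup.mk w ∈ R) * (2 * Fintype.card α - 1) ^ L ≤
      M * #(reducedWords α n) := by
  obtain ⟨n, rfl⟩ := Nat.exists_eq_add_of_le hn
  have h1 : #((reducedWords α (L + n)).filter fun w => FreeGroup.mk w ∈ R) ≤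
      2 * Fintype.card α * (M * (2 * Fintype.card α - 1) ^ n) := by
    rw [reducedWords, card_filter_biUnion_cons]
    calc _ ≤ ∑ b : α × Bool, M * (2 * Fintype.card α - 1) ^ n := by
          refine sum_le_sum fun b _ => ?_
          refine (congrArg card (filter_congr fun w _ => ?_)).trans_le
            (card_reducedContinuations_filter_le h n b (FreeGroup.mk [b]))
          rw [FreeGroup.mul_mk, List.singleton_append]
      _ = _ := by
          rw [sum_const, card_univ, smul_eq_mul]
          simp [mul_comm]
  calc _ ≤ 2 * Fintype.card α * (M * (2 * Fintype.card α - 1) ^ n) *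
        (2 * Fintype.card α - 1) ^ L := Nat.mul_le_mul_right _ h1
    _ = _ := by rw [card_reducedWords, pow_add]; ring

open Classical in
theorem card_filter_permKernel_le_one {L j : ℕ} (hj : 2 * L + 1 ≤ j) (c : α × Bool)
    (t : FreeGroup α) :
    #((reducedContinuations L c).filter
      fun w => t * FreeGroup.mk w ∈ permKernel (FreeGroup α) j) ≤ 1 := by
  rw [card_le_one]
  intro w hw w' hw'
  rw [mem_filter, mem_reducedContinuations] at hw hw'
  have hred {w} (h : FreeGroup.IsReduced (c :: w)) : FreeGroup.IsReduced w :=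
    h.infix ⟨[c], [], by simp⟩
  have hmem := mul_mem (inv_mem hw.2) hw'.2
  rw [mul_inv_rev, mul_assoc, inv_mul_cancel_left] at hmem
  have heq : (FreeGroup.mk w)⁻¹ * FreeGroup.mk w' = 1 := by
    by_contra hne
    refine notMem_permKernel hne (le_trans ?_ hj) hmem
    have h0 := FreeGroup.norm_mul_le (FreeGroup.mk w)⁻¹ (FreeGroup.mk w')
    have h1 := FreeGroup.norm_mk_le (L₁ := w)
    have h2 := FreeGroup.norm_mk_le (L₁ := w')
    rw [FreeGroup.norm_inv_eq] at h0
    have h3 := hw.1.1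
    have h4 := hw'.1.1
    omega
  have := FreeGroup.reduce.sound (inv_mul_eq_one.1 heq)
  rwa [(hred hw.1.2).reduce_eq, (hred hw'.1.2).reduce_eq] at this

open Classical in
theorem card_filter_permKernel_two_le (c : α × Bool) {j : ℕ} (hj : 2 ≤ j) (t : FreeGroup α) :
    #((reducedContinuations 1 c).filter
      fun w => t * FreeGroup.mk w ∈ permKernel (FreeGroup α) j) ≤ 2 := by
  rcases eq_empty_or_nonempty ((reducedContinuations 1 c).filter
      fun w => t * FreeGroup.mk w ∈ permKernel (FreeGroup α) j) with h | ⟨w, hw⟩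
  · simp [h]
  rw [mem_filter, mem_reducedContinuations] at hw
  obtain ⟨⟨a, x⟩, rfl⟩ := List.length_eq_one_iff.1 hw.1.1
  refine (card_le_card (t := {[(a, true)], [(a, false)]}) fun w' hw' => ?_).trans card_le_two
  rw [mem_filter, mem_reducedContinuations] at hw'
  obtain ⟨⟨a', x'⟩, rfl⟩ := List.length_eq_one_iff.1 hw'.1.1
  have hmem := mul_mem (inv_mem hw.2) hw'.2
  rw [mul_inv_rev, mul_assoc, inv_mul_cancel_left] at hmem
  let ψ : FreeGroup α →* Multiplicative (ZMod 2) :=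
    FreeGroup.lift fun i => Multiplicative.ofAdd (if i = a then 1 else 0)
  have h := map_eq_one_of_mem_permKernel (by simpa [ZMod.card]) ψ hmem
  have haa : a' = a := by
    by_contra hne
    rw [map_mul, map_inv, inv_mul_eq_one, FreeGroup.lift_mk, FreeGroup.lift_mk] at h
    cases x <;> cases x' <;> simp [hne] at h
  subst haa
  cases x' <;> simp

theorem card_filter_eq_reducedWalkCount {G : Type*} [Group G] [DecidableEq G]
    (ψ : FreeGroup α →* G) (n : ℕ) (c : α × Bool) (s : G) :
    #((reducedContinuations n c).filter fun w => s * ψ (FreeGroup.mk w) = 1) =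
      reducedWalkCount (fun b => ψ (FreeGroup.mk [b])) n c s := by
  induction n generalizing c s with
  | zero =>
    rw [reducedContinuations, reducedWalkCount, filter_singleton, ← FreeGroup.one_eq_mk, map_one,
      mul_one]
    split_ifs <;> simp
  | succ n ih =>
    rw [reducedContinuations, card_filter_biUnion_cons, reducedWalkCount, sum_filter]
    refine sum_congr rfl fun b _ => ?_
    congr 1
    rw [← ih]
    congr 2 with w
    rw [mul_assoc, ← map_mul, FreeGroup.mul_mk, List.singleton_append]

open Classical in
theorem card_filter_mem_le_of_reducedWalkCount_le {G : Type*} [Group G] [DecidableEq G]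
    (ψ : FreeGroup α →* G) {R : Subgroup (FreeGroup α)} (hR : ∀ g ∈ R, ψ g = 1) {L M : ℕ}
    (h : ∀ c s, reducedWalkCount (fun b => ψ (FreeGroup.mk [b])) L c s ≤ M)
    (c : α × Bool) (t : FreeGroup α) :
    #((reducedContinuations L c).filter fun w => t * FreeGroup.mk w ∈ R) ≤ M := by
  refine le_trans (card_le_card ?_) ((card_filter_eq_reducedWalkCount ψ L c (ψ t)).trans_le (h c _))
  refine monotone_filter_right _ fun w _ hw => ?_
  rw [← map_mul]
  exact hR _ hw

end Words

theorem sum_pow_half_le {r : ℝ} (h0 : 0 ≤ r) (h1 : r < 1) (a N : ℕ) :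
    ∑ j ∈ Ico (2 * a + 1) N, r ^ ((j - 1) / 2) ≤ 2 * r ^ a / (1 - r) := by
  have hsum : ∀ M : ℕ, ∑ j ∈ Ico (2 * a + 1) (2 * a + 1 + 2 * M), r ^ ((j - 1) / 2) =
      2 * r ^ a * (1 - r ^ M) / (1 - r) := by
    have hr : 1 - r ≠ 0 := by linarith
    intro M
    induction M with
    | zero => simp
    | succ M ih =>
      rw [show 2 * a + 1 + 2 * (M + 1) = 2 * a + 1 + 2 * M + 1 + 1 by ring,
        sum_Ico_succ_top (by omega), sum_Ico_succ_top (by omega), ih,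
        show (2 * a + 1 + 2 * M - 1) / 2 = a + M by omega,
        show (2 * a + 1 + 2 * M + 1 - 1) / 2 = a + M by omega]
      field_simp
      ring
  calc _ ≤ ∑ j ∈ Ico (2 * a + 1) (2 * a + 1 + 2 * N), r ^ ((j - 1) / 2) :=
        sum_le_sum_of_subset_of_nonneg (Ico_subset_Ico_right (by omega))
          fun _ _ _ => pow_nonneg h0 _
    _ = _ := hsum N
    _ ≤ _ := by
        have : 0 ≤ r ^ N := pow_nonneg h0 N
        have : 0 ≤ r ^ a := pow_nonneg h0 a
        refine div_le_div_of_nonneg_right ?_ (by linarith)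
        nlinarith

open Classical in
theorem sum_leastAvoidingIndex_reducedWords_le (k n : ℕ) :
    ∑ w ∈ reducedWords (Fin k) n, leastAvoidingIndex k (FreeGroup.mk w) ≤
      2 * #(reducedWords (Fin k) n) + ∑ j ∈ Ico 2 (n + 2),
        #((reducedWords (Fin k) n).filter
          fun w => FreeGroup.mk w ∈ permKernel (FreeGroup (Fin k)) j) := by
  have hle : ∀ w ∈ reducedWords (Fin k) n, leastAvoidingIndex k (FreeGroup.mk w) ≤
      2 + ∑ j ∈ Ico 2 (n + 2),
        if FreeGroup.mk w ∈ permKernel (FreeGroup (Fin k)) j then 1 else 0 := by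
    intro w hw
    obtain ⟨hlen, hred⟩ := mem_reducedWords.1 hw
    have hnorm : (FreeGroup.mk w).norm = n + 1 := by
      rw [FreeGroup.norm, FreeGroup.toWord_mk, hred.reduce_eq, hlen]
    have hne : FreeGroup.mk w ≠ 1 := by
      rw [ne_eq, ← FreeGroup.norm_eq_zero, hnorm]
      omega
    have hm := leastAvoidingIndex_le hne
    rw [← card_filter]
    have hsub : Ico 2 (leastAvoidingIndex k (FreeGroup.mk w)) ⊆
        {j ∈ Ico 2 (n + 2) | FreeGroup.mk w ∈ permKernel (FreeGroup (Fin k)) j} := by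
      intro j hj
      rw [mem_Ico] at hj
      rw [mem_filter, mem_Ico]
      exact ⟨⟨hj.1, by omega⟩, mem_permKernel_of_lt hj.2⟩
    have hcard := card_le_card hsub
    rw [Nat.card_Ico] at hcard
    omega
  refine (sum_le_sum hle).trans_eq ?_
  rw [sum_add_distrib, sum_const, smul_eq_mul, mul_comm, sum_comm]
  simp only [card_filter]

open Classical in
/-- The proportion of reduced words of length `n + 1` in `F_k` that act trivially in every
permutation representation on `j` points. -/
noncomputable def permKernelDensity (k n j : ℕ) : ℝ :=
  #((reducedWords (Fin k) n).filter
    fun w => FreeGroup.mk w ∈ permKernel (FreeGroup (Fin k)) j) / #(reducedWords (Fin k) n)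

open Classical in
theorem permKernelDensity_le_one (k n j : ℕ) : permKernelDensity k n j ≤ 1 :=
  div_le_one_of_le₀ (Nat.cast_le.2 (card_filter_le _ _)) (Nat.cast_nonneg _)

theorem card_reducedWords_pos {k : ℕ} (hk : 2 ≤ k) (n : ℕ) :
    0 < #(reducedWords (Fin k) n) := by
  rw [card_reducedWords, Fintype.card_fin]
  have : 0 < 2 * k - 1 := by omega
  positivity

open Classical in
theorem permKernelDensity_le {k : ℕ} (hk : 2 ≤ k) {L M n j : ℕ}
    (h : ∀ c t, #((reducedContinuations L c).filter
      fun w => t * FreeGroup.mk w ∈ permKernel (FreeGroup (Fin k)) j) ≤ M) (hn : L ≤ n) :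
    permKernelDensity k n j ≤ M * (1 / (2 * k - 1) : ℝ) ^ L := by
  have h1 := card_reducedWords_filter_mem_le h hn
  rw [Fintype.card_fin] at h1
  have hpos : (0 : ℝ) < #(reducedWords (Fin k) n) := by exact_mod_cast card_reducedWords_pos hk n
  have hq : (0 : ℝ) < 2 * k - 1 := by
    have : (2 : ℝ) ≤ k := by exact_mod_cast hk
    linarith
  have hcast : ((2 * k - 1 : ℕ) : ℝ) = 2 * k - 1 := by
    rw [Nat.cast_sub (by omega)]
    push_cast
    ring
  rw [permKernelDensity, div_le_iff₀ hpos, one_div, inv_pow, ← div_eq_mul_inv, div_mul_eq_mul_div,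
    le_div_iff₀ (by positivity), ← hcast]
  exact_mod_cast h1

theorem permKernelDensity_le_pow {k : ℕ} (hk : 2 ≤ k) {n j : ℕ} (hj : 1 ≤ j) (hn : j ≤ n + 1) :
    permKernelDensity k n j ≤ (1 / (2 * k - 1) : ℝ) ^ ((j - 1) / 2) := by
  simpa using permKernelDensity_le hk (M := 1)
    (card_filter_permKernel_le_one (α := Fin k) (L := (j - 1) / 2) (j := j) (by omega))
    (by omega : (j - 1) / 2 ≤ n)

theorem permKernelDensity_two_le {k : ℕ} (hk : 2 ≤ k) {n : ℕ} (hn : 1 ≤ n) :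
    permKernelDensity k n 2 ≤ 2 * (1 / (2 * k - 1) : ℝ) := by
  simpa using permKernelDensity_le hk (M := 2)
    (fun c t => card_filter_permKernel_two_le (α := Fin k) c le_rfl t) hn

theorem sum_permKernelDensity_le_one_of_three_le {k : ℕ} (hk : 3 ≤ k) (n : ℕ) :
    ∑ j ∈ Ico 2 (n + 2), permKernelDensity k n j ≤ 1 := by
  rcases Nat.eq_zero_or_pos n with rfl | hn
  · simp
  have hk' : (3 : ℝ) ≤ k := by exact_mod_cast hk
  set r : ℝ := 1 / (2 * k - 1) with hr
  have hr0 : 0 ≤ r := by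
    have : (0 : ℝ) ≤ 2 * k - 1 := by linarith
    positivity
  have hr5 : r ≤ 1 / 5 := by
    rw [hr]
    exact one_div_le_one_div_of_le (by norm_num) (by linarith)
  rw [sum_eq_sum_Ico_succ_bot (by omega)]
  have htail : ∑ j ∈ Ico (2 + 1) (n + 2), permKernelDensity k n j ≤ 2 * r ^ 1 / (1 - r) := by
    refine (sum_le_sum fun j hj => ?_).trans (sum_pow_half_le hr0 (by linarith) 1 (n + 2))
    rw [mem_Ico] at hj
    exact permKernelDensity_le_pow (by omega) (by omega) (by omega)
  have h2 := permKernelDensity_two_le (by omega : 2 ≤ k) hn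
  have : 2 * r ^ 1 / (1 - r) ≤ 1 / 2 := by
    rw [div_le_iff₀ (by linarith)]
    linarith
  linarith

/-- The standard generators of `(ℤ/m)²`, written multiplicatively, and their inverses. -/
def zmodLetter (m : ℕ) (b : Fin 2 × Bool) : Multiplicative (ZMod m × ZMod m) :=
  let x := Multiplicative.ofAdd (if b.1 = 0 then (1, 0) else (0, 1))
  if b.2 then x else x⁻¹

theorem card_filter_permKernel_le_of_zmod {j m a b : ℕ} [NeZero m] [NeZero a] [NeZero b]
    (hm : m = a * b) (hab : a.Coprime b) (ha : a ≤ j) (hb : b ≤ j) {L M : ℕ}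
    (h : ∀ c s, reducedWalkCount (zmodLetter m) L c s ≤ M) (c : Fin 2 × Bool)
    (t : FreeGroup (Fin 2))
    [DecidablePred fun w => t * FreeGroup.mk w ∈ permKernel (FreeGroup (Fin 2)) j] :
    #((reducedContinuations L c).filter
      fun w => t * FreeGroup.mk w ∈ permKernel (FreeGroup (Fin 2)) j) ≤ M := by
  let ψ : FreeGroup (Fin 2) →* Multiplicative (ZMod m × ZMod m) :=
    FreeGroup.lift fun i => zmodLetter m (i, true)
  have hψ : (fun b => ψ (FreeGroup.mk [b])) = zmodLetter m := by
    funext ⟨i, x⟩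
    cases x <;> simp [ψ, zmodLetter]
  have hker : ∀ g ∈ permKernel (FreeGroup (Fin 2)) j, ψ g = 1 := by
    intro g hg
    have h1 := zmod_map_eq_one_of_mem_permKernel hm hab ha hb
      ((AddMonoidHom.toMultiplicative (AddMonoidHom.fst (ZMod m) (ZMod m))).comp ψ) hg
    have h2 := zmod_map_eq_one_of_mem_permKernel hm hab ha hb
      ((AddMonoidHom.toMultiplicative (AddMonoidHom.snd (ZMod m) (ZMod m))).comp ψ) hg
    exact Prod.ext h1 h2
  convert card_filter_mem_le_of_reducedWalkCount_le ψ hker (hψ ▸ h) c t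

theorem reducedWalkCount_zmod_two_le : ∀ c s, reducedWalkCount (zmodLetter 2) 3 c s ≤ 15 := by
  decide +kernel

theorem reducedWalkCount_zmod_six_le : ∀ c s, reducedWalkCount (zmodLetter 6) 3 c s ≤ 3 := by
  decide +kernel

theorem reducedWalkCount_zmod_twelve_le :
    ∀ c s, reducedWalkCount (zmodLetter 12) 4 c s ≤ 6 := by
  decide +kernel

open Classical in
theorem permKernelDensity_rank_two_le {j n : ℕ} (hj : 2 ≤ j) (hn : 3 ≤ n) :
    permKernelDensity 2 n j ≤ 5 / 9 := by
  refine (permKernelDensity_le le_rfl (fun c t => card_filter_permKernel_le_of_zmod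
    (a := 1) (b := 2) (by norm_num) (by norm_num) (by omega) hj
    reducedWalkCount_zmod_two_le c t) hn).trans ?_
  norm_num

open Classical in
theorem permKernelDensity_rank_two_le_of_three_le {j n : ℕ} (hj : 3 ≤ j) (hn : 3 ≤ n) :
    permKernelDensity 2 n j ≤ 1 / 9 := by
  refine (permKernelDensity_le le_rfl (fun c t => card_filter_permKernel_le_of_zmod
    (a := 2) (b := 3) (by norm_num) (by norm_num) (by omega) hj
    reducedWalkCount_zmod_six_le c t) hn).trans ?_
  norm_num

open Classical in
theorem permKernelDensity_rank_two_le_of_four_le {j n : ℕ} (hj : 4 ≤ j) (hn : 4 ≤ n) :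
    permKernelDensity 2 n j ≤ 2 / 27 := by
  refine (permKernelDensity_le le_rfl (fun c t => card_filter_permKernel_le_of_zmod
    (a := 3) (b := 4) (by norm_num) (by norm_num) (by omega) hj
    reducedWalkCount_zmod_twelve_le c t) hn).trans ?_
  norm_num

theorem permKernelDensity_nonneg (k n j : ℕ) : 0 ≤ permKernelDensity k n j := by
  unfold permKernelDensity
  positivity

theorem sum_permKernelDensity_rank_two_le_one (n : ℕ) :
    ∑ j ∈ Ico 2 (n + 2), permKernelDensity 2 n j ≤ 1 := by
  obtain rfl | rfl | rfl | rfl | hn : n = 0 ∨ n = 1 ∨ n = 2 ∨ n = 3 ∨ 4 ≤ n := by omega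
  · simp
  · simpa using permKernelDensity_le_one 2 1 2
  · have h2 := permKernelDensity_two_le le_rfl (by norm_num : 1 ≤ 2)
    have h3 := permKernelDensity_le_pow (k := 2) (n := 2) (j := 3) le_rfl (by norm_num) le_rfl
    norm_num [sum_Ico_succ_top] at h2 h3 ⊢
    linarith
  · have h2 := permKernelDensity_rank_two_le (j := 2) le_rfl (le_refl 3)
    have h3 := permKernelDensity_rank_two_le_of_three_le (j := 3) le_rfl (le_refl 3)
    have h4 := permKernelDensity_rank_two_le_of_three_le (j := 4) (by norm_num) (le_refl 3)
    norm_num [sum_Ico_succ_top]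
    linarith
  · have h2 := permKernelDensity_rank_two_le (j := 2) le_rfl (by omega : 3 ≤ n)
    have h3 := permKernelDensity_rank_two_le_of_three_le (j := 3) le_rfl (by omega : 3 ≤ n)
    have h4 := permKernelDensity_rank_two_le_of_four_le (j := 4) le_rfl hn
    have h5 := permKernelDensity_rank_two_le_of_four_le (j := 5) (by norm_num) hn
    have h6 := permKernelDensity_rank_two_le_of_four_le (j := 6) (by norm_num) hn
    have htail : ∑ j ∈ Ico 7 (n + 2), permKernelDensity 2 n j ≤ 1 / 9 := by
      refine (sum_le_sum fun j hj => ?_).trans ((sum_pow_half_le (r := 1 / 3) (by norm_num)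
        (by norm_num) 3 (n + 2)).trans (by norm_num))
      rw [mem_Ico] at hj
      refine (permKernelDensity_le_pow le_rfl (by omega) (by omega)).trans_eq ?_
      norm_num
    have hsplit : ∑ j ∈ Ico 2 (n + 2), permKernelDensity 2 n j ≤
        ∑ j ∈ Ico 2 7, permKernelDensity 2 n j +
          ∑ j ∈ Ico 7 (n + 2), permKernelDensity 2 n j := by
      rw [← sum_union (Ico_disjoint_Ico_consecutive 2 7 (n + 2))]
      refine sum_le_sum_of_subset_of_nonneg (fun j hj => ?_)
        fun j _ _ => permKernelDensity_nonneg 2 n j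
      rw [mem_union, mem_Ico, mem_Ico]
      rw [mem_Ico] at hj
      omega
    norm_num [sum_Ico_succ_top] at hsplit
    linarith

/-- The average of the least avoiding index over each sphere is at most `3`. -/
theorem sum_leastAvoidingIndex_reducedWords_le_three_mul {k : ℕ} (hk : 2 ≤ k) (n : ℕ) :
    ∑ w ∈ reducedWords (Fin k) n, (leastAvoidingIndex k (FreeGroup.mk w) : ℝ) ≤
      3 * #(reducedWords (Fin k) n) := by
  classical
  have hsum : ∑ j ∈ Ico 2 (n + 2), permKernelDensity k n j ≤ 1 := by
    obtain rfl | hk := hk.eq_or_lt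
    · exact sum_permKernelDensity_rank_two_le_one n
    · exact sum_permKernelDensity_le_one_of_three_le hk n
  have hpos : (0 : ℝ) < #(reducedWords (Fin k) n) := by exact_mod_cast card_reducedWords_pos hk n
  simp only [permKernelDensity] at hsum
  rw [← sum_div, div_le_one hpos] at hsum
  have h : ((∑ w ∈ reducedWords (Fin k) n, leastAvoidingIndex k (FreeGroup.mk w) : ℕ) : ℝ) ≤ _ :=
    Nat.cast_le.2 (sum_leastAvoidingIndex_reducedWords_le k n)
  push_cast at h
  linarith

/-- The nontrivial elements of length at most `N`. -/
def puncturedBall (k N : ℕ) : Finset (FreeGroup (Fin k)) :=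
  ((range N).biUnion (reducedWords (Fin k))).image FreeGroup.mk

theorem mem_puncturedBall {k N : ℕ} {g : FreeGroup (Fin k)} :
    g ∈ puncturedBall k N ↔ g ≠ 1 ∧ g.norm ≤ N := by
  simp only [puncturedBall, mem_image, mem_biUnion, mem_range, mem_reducedWords]
  rw [ne_eq, ← FreeGroup.norm_eq_zero]
  constructor
  · rintro ⟨w, ⟨n, hn, hlen, hred⟩, rfl⟩
    rw [FreeGroup.norm, FreeGroup.toWord_mk, hred.reduce_eq]
    omega
  · rintro ⟨h0, hN⟩
    rw [FreeGroup.norm] at h0 hN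
    exact ⟨g.toWord, ⟨g.toWord.length - 1, by omega, by omega, FreeGroup.isReduced_toWord⟩,
      FreeGroup.mk_toWord⟩

theorem sum_puncturedBall (k N : ℕ) (f : FreeGroup (Fin k) → ℝ) :
    ∑ g ∈ puncturedBall k N, f g =
      ∑ n ∈ range N, ∑ w ∈ reducedWords (Fin k) n, f (FreeGroup.mk w) := by
  rw [puncturedBall, sum_image, sum_biUnion]
  · intro n _ n' _ hne
    rw [Function.onFun, disjoint_left]
    intro w hw hw'
    have h1 := (mem_reducedWords.1 hw).1
    have h2 := (mem_reducedWords.1 hw').1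
    omega
  · intro w hw w' hw' h
    simp only [coe_biUnion, Set.mem_iUnion, mem_coe, mem_reducedWords] at hw hw'
    obtain ⟨_, _, _, hw⟩ := hw
    obtain ⟨_, _, _, hw'⟩ := hw'
    have := FreeGroup.reduce.sound h
    rwa [hw.reduce_eq, hw'.reduce_eq] at this

/-- **The average least avoiding index over balls in a free group is at most 3.**
For the free group `F_k` (`k ≥ 2`), the limsup over `N` of the average, over the
nontrivial elements of word length at most `N`, of the least index of a subgroup
not containing the element, is at most `3`. -/
theorem limsup_average_leastAvoidingIndex_le_three
    (k : ℕ) (hk : 2 ≤ k) :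
    Filter.limsup
      (fun N : ℕ =>
        (∑' g : {g : FreeGroup (Fin k) // g ≠ 1 ∧ FreeGroup.norm g ≤ N},
            (leastAvoidingIndex k g.val : ℝ)) /
          (Nat.card {g : FreeGroup (Fin k) // g ≠ 1 ∧ FreeGroup.norm g ≤ N} : ℝ))
      Filter.atTop ≤ 3 := by
  refine Filter.limsup_le_of_le
    (Filter.isCoboundedUnder_le_of_le Filter.atTop (x := 0) fun N =>
      div_nonneg (tsum_nonneg fun _ => Nat.cast_nonneg _) (Nat.cast_nonneg _))
    (Filter.Eventually.of_forall fun N => ?_)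
  have hset : {g : FreeGroup (Fin k) | g ≠ 1 ∧ FreeGroup.norm g ≤ N} = puncturedBall k N := by
    ext g
    exact mem_puncturedBall.symm
  have htsum : ∑' g : {g : FreeGroup (Fin k) // g ≠ 1 ∧ FreeGroup.norm g ≤ N},
      (leastAvoidingIndex k g.val : ℝ) =
      ∑ g ∈ puncturedBall k N, (leastAvoidingIndex k g : ℝ) := by
    change ∑' g : {g : FreeGroup (Fin k) | g ≠ 1 ∧ FreeGroup.norm g ≤ N},
      (leastAvoidingIndex k g.val : ℝ) = _
    rw [hset]
    exact Finset.tsum_subtype' (puncturedBall k N) fun g => (leastAvoidingIndex k g : ℝ)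
  have hcard : (Nat.card {g : FreeGroup (Fin k) // g ≠ 1 ∧ FreeGroup.norm g ≤ N} : ℝ) =
      ∑ g ∈ puncturedBall k N, (1 : ℝ) := by
    change (Nat.card {g : FreeGroup (Fin k) | g ≠ 1 ∧ FreeGroup.norm g ≤ N} : ℝ) = _
    rw [hset]
    simp
  rw [htsum, hcard, sum_puncturedBall, sum_puncturedBall]
  refine div_le_of_le_mul₀ (by positivity) (by norm_num) ?_
  rw [mul_sum]
  refine sum_le_sum fun n _ => ?_
  simpa using sum_leastAvoidingIndex_reducedWords_le_three_mul hk n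
end

section
/- For an integer n ≥ 1, let P(n) denote the smallest prime that does not divide n. Then the averages (1/N)·∑_{n=1}^{N} P(n) converge, as N → ∞, to the sum over all primes p of (p−1)/∏_{q prime, q < p} q, a constant approximately equal to 2.92005. -/
/-- `smallestNonDivisorPrime n` is the smallest prime that does not divide `n`. -/
noncomputable def smallestNonDivisorPrime (n : ℕ) : ℕ :=
  sInf {p | p.Prime ∧ ¬ p ∣ n}

open Finset Filter Topology in
/-- The quotients `⌊N / d⌋ / N` converge to `1 / d`. -/
theorem tendsto_natDiv_div_atTop (d : ℕ) :
    Tendsto (fun N : ℕ => ((N / d : ℕ) : ℝ) / N) atTop (𝓝 (d : ℝ)⁻¹) := by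
  have h := (tendsto_nat_floor_mul_div_atTop (R := ℝ) (a := (d : ℝ)⁻¹) (by positivity)).comp
    tendsto_natCast_atTop_atTop
  refine h.congr fun N => ?_
  rw [Function.comp_apply, mul_comm, ← div_eq_mul_inv, Nat.floor_div_eq_div]

/-- A product of distinct primes divides `n` iff each of them does. -/
theorem prod_primes_dvd_iff {s : Finset ℕ} (hs : ∀ q ∈ s, q.Prime) (n : ℕ) :
    ∏ q ∈ s, q ∣ n ↔ ∀ q ∈ s, q ∣ n :=
  ⟨fun h _ hq => (Finset.dvd_prod_of_mem _ hq).trans h,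
    fun h => Finset.prod_primes_dvd n (fun q hq => (hs q hq).prime) h⟩

theorem prod_primes_below_pos (p : ℕ) : 0 < ∏ q ∈ (Finset.range p).filter Nat.Prime, q :=
  Finset.prod_pos fun _ hq => (Finset.mem_filter.1 hq).2.pos

theorem smallestNonDivisorPrime_mem {n : ℕ} (hn : n ≠ 0) :
    (smallestNonDivisorPrime n).Prime ∧ ¬ smallestNonDivisorPrime n ∣ n := by
  obtain ⟨p, hnp, hp⟩ := Nat.exists_infinite_primes (n + 1)
  exact Nat.sInf_mem (s := {p | p.Prime ∧ ¬ p ∣ n})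
    ⟨p, hp, fun h => by have := Nat.le_of_dvd (Nat.pos_of_ne_zero hn) h; omega⟩

theorem smallestNonDivisorPrime_eq_iff {n p : ℕ} (hn : n ≠ 0) (hp : p.Prime) :
    smallestNonDivisorPrime n = p ↔
      ∏ q ∈ (Finset.range p).filter Nat.Prime, q ∣ n ∧
        ¬ (∏ q ∈ (Finset.range p).filter Nat.Prime, q) * p ∣ n := by
  have hprimes : ∀ q ∈ (Finset.range p).filter Nat.Prime, q.Prime :=
    fun q hq => (Finset.mem_filter.1 hq).2
  have hcop : Nat.Coprime (∏ q ∈ (Finset.range p).filter Nat.Prime, q) p := by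
    refine Nat.Coprime.prod_left fun q hq => (Nat.coprime_primes (hprimes q hq) hp).2 ?_
    have := Finset.mem_range.1 (Finset.mem_filter.1 hq).1
    omega
  have hmem := smallestNonDivisorPrime_mem hn
  constructor
  · rintro rfl
    refine ⟨(prod_primes_dvd_iff hprimes n).2 fun q hq => ?_,
      fun h => hmem.2 ((dvd_mul_left _ _).trans h)⟩
    by_contra hqn
    have hle : smallestNonDivisorPrime n ≤ q :=
      Nat.sInf_le (s := {p | p.Prime ∧ ¬ p ∣ n}) ⟨hprimes q hq, hqn⟩
    have := Finset.mem_range.1 (Finset.mem_filter.1 hq).1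
    omega
  · rintro ⟨hM, hMp⟩
    have hpn : ¬ p ∣ n := fun h => hMp (hcop.mul_dvd_of_dvd_of_dvd hM h)
    refine le_antisymm (Nat.sInf_le (s := {p | p.Prime ∧ ¬ p ∣ n}) ⟨hp, hpn⟩) ?_
    by_contra! hlt
    exact hmem.2 ((prod_primes_dvd_iff hprimes n).1 hM _
      (Finset.mem_filter.2 ⟨Finset.mem_range.2 hlt, hmem.1⟩))

/-- The number of `n ≤ N` whose smallest non-dividing prime is `p`. -/
theorem card_smallestNonDivisorPrime_eq (N : ℕ) {p : ℕ} (hp : p.Prime) :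
    (((Finset.Icc 1 N).filter fun n => smallestNonDivisorPrime n = p).card : ℝ) =
      ((N / ∏ q ∈ (Finset.range p).filter Nat.Prime, q : ℕ) : ℝ) -
        ((N / ((∏ q ∈ (Finset.range p).filter Nat.Prime, q) * p) : ℕ) : ℝ) := by
  set M := ∏ q ∈ (Finset.range p).filter Nat.Prime, q
  have hIcc : Finset.Icc 1 N = Finset.Ioc 0 N := rfl
  have hfilter : ((Finset.Icc 1 N).filter fun n => smallestNonDivisorPrime n = p) =
      ((Finset.Ioc 0 N).filter (M ∣ ·)) \ ((Finset.Ioc 0 N).filter (M * p ∣ ·)) := by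
    ext n
    simp only [hIcc, Finset.mem_filter, Finset.mem_sdiff]
    constructor
    · rintro ⟨hn, h⟩
      have h' := (smallestNonDivisorPrime_eq_iff (by have := Finset.mem_Ioc.1 hn; omega) hp).1 h
      exact ⟨⟨hn, h'.1⟩, fun h'' => h'.2 h''.2⟩
    · rintro ⟨⟨hn, h1⟩, h2⟩
      exact ⟨hn, (smallestNonDivisorPrime_eq_iff (by have := Finset.mem_Ioc.1 hn; omega) hp).2
        ⟨h1, fun h => h2 ⟨hn, h⟩⟩⟩
  have hsub : ((Finset.Ioc 0 N).filter (M * p ∣ ·)) ⊆ ((Finset.Ioc 0 N).filter (M ∣ ·)) :=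
    Finset.monotone_filter_right _ fun n _ h => (dvd_mul_right M p).trans h
  rw [hfilter, Finset.cast_card_sdiff hsub, Nat.Ioc_filter_dvd_card_eq_div,
    Nat.Ioc_filter_dvd_card_eq_div]

/-- A cubic lower bound for the product of the primes below `p`, from Bertrand's postulate. -/
theorem pow_three_le_mul_prod_primes_below (p : ℕ) :
    p ^ 3 ≤ 729 * ∏ q ∈ (Finset.range p).filter Nat.Prime, q := by
  have hpos := prod_primes_below_pos p
  rcases Nat.lt_or_ge p 9 with hp | hp
  · have : p ^ 3 ≤ 9 ^ 3 := Nat.pow_le_pow_left hp.le 3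
    omega
  obtain ⟨m, hm⟩ : ∃ m, m = (p - 1) / 8 := ⟨_, rfl⟩
  obtain ⟨a, ha, hma, ham⟩ := Nat.exists_prime_lt_and_le_two_mul m (by omega)
  obtain ⟨b, hb, hmb, hbm⟩ := Nat.exists_prime_lt_and_le_two_mul (2 * m) (by omega)
  obtain ⟨c, hc, hmc, hcm⟩ := Nat.exists_prime_lt_and_le_two_mul (4 * m) (by omega)
  have hsub : ({a, b, c} : Finset ℕ) ⊆ (Finset.range p).filter Nat.Prime := by
    intro q hq
    simp only [Finset.mem_insert, Finset.mem_singleton] at hq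
    rcases hq with rfl | rfl | rfl <;>
      exact Finset.mem_filter.2 ⟨Finset.mem_range.2 (by omega), by assumption⟩
  have hprod : ∏ q ∈ ({a, b, c} : Finset ℕ), q = a * (b * c) := by
    rw [Finset.prod_insert, Finset.prod_insert, Finset.prod_singleton]
    · simp only [Finset.mem_singleton]; omega
    · simp only [Finset.mem_insert, Finset.mem_singleton]; omega
  have hle : a * (b * c) ≤ ∏ q ∈ (Finset.range p).filter Nat.Prime, q := by
    rw [← hprod]
    exact Finset.prod_le_prod_of_subset_of_one_le' hsub
      fun q hq _ => (Finset.mem_filter.1 hq).2.one_le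
  calc p ^ 3 = p * (p * p) := by ring
    _ ≤ (8 * a) * ((8 * b) * (8 * c)) := by gcongr <;> omega
    _ = 512 * (a * (b * c)) := by ring
    _ ≤ 729 * ∏ q ∈ (Finset.range p).filter Nat.Prime, q := by gcongr; norm_num

theorem summable_div_prod_primes_below :
    Summable fun p : {p : ℕ // p.Prime} =>
      ((p : ℕ) : ℝ) / ((∏ q ∈ (Finset.range (p : ℕ)).filter Nat.Prime, q : ℕ) : ℝ) := by
  have hsq : Summable fun p : {p : ℕ // p.Prime} => 729 * (1 / (((p : ℕ) : ℝ) ^ 2)) :=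
    ((Real.summable_one_div_nat_pow.2 one_lt_two).subtype {p | p.Prime}).mul_left 729
  refine Summable.of_nonneg_of_le (fun p => by positivity) (fun p => ?_) hsq
  have hp : (0 : ℝ) < (p : ℕ) := by exact_mod_cast p.2.pos
  have hM : (0 : ℝ) < ((∏ q ∈ (Finset.range (p : ℕ)).filter Nat.Prime, q : ℕ) : ℝ) := by
    exact_mod_cast prod_primes_below_pos p
  have h : ((p : ℕ) : ℝ) ^ 3 ≤
      729 * ((∏ q ∈ (Finset.range (p : ℕ)).filter Nat.Prime, q : ℕ) : ℝ) := by
    exact_mod_cast pow_three_le_mul_prod_primes_below p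
  rw [mul_one_div, div_le_div_iff₀ hM (by positivity)]
  linarith [h, pow_succ' ((p : ℕ) : ℝ) 2]

/-- Summing `smallestNonDivisorPrime` by grouping the integers according to its value. -/
theorem sum_smallestNonDivisorPrime_eq_tsum (N : ℕ) :
    ∑ n ∈ Finset.Icc 1 N, (smallestNonDivisorPrime n : ℝ) =
      ∑' p : {p : ℕ // p.Prime},
        (((Finset.Icc 1 N).filter fun n => smallestNonDivisorPrime n = p).card : ℝ) *
          ((p : ℕ) : ℝ) := by
  have hsingle : ∀ n ∈ Finset.Icc 1 N, HasSum
      (fun p : {p : ℕ // p.Prime} =>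
        if smallestNonDivisorPrime n = p then ((p : ℕ) : ℝ) else 0)
      (smallestNonDivisorPrime n : ℝ) := by
    intro n hn
    have hmem := smallestNonDivisorPrime_mem (n := n) (by have := Finset.mem_Icc.1 hn; omega)
    have h := hasSum_single (f := fun p : {p : ℕ // p.Prime} =>
        if smallestNonDivisorPrime n = p then ((p : ℕ) : ℝ) else 0)
      ⟨smallestNonDivisorPrime n, hmem.1⟩
      (fun p hp => if_neg fun h => hp (Subtype.ext h.symm))
    simpa using h
  rw [← (hasSum_sum hsingle).tsum_eq]
  refine tsum_congr fun p => ?_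
  rw [← Finset.sum_filter, Finset.sum_const, nsmul_eq_mul]

/-- **Average of the smallest prime not dividing `n`.**
The averages `(1/N)·∑_{n=1}^N P(n)` converge, as `N → ∞`, to
`∑_p (p−1)/∏_{q prime, q < p} q ≈ 2.92005`. -/
theorem average_smallestNonDivisorPrime_tendsto :
    Filter.Tendsto
      (fun N : ℕ => (∑ n ∈ Finset.Icc 1 N, (smallestNonDivisorPrime n : ℝ)) / (N : ℝ))
      Filter.atTop
      (nhds (∑' p : {p : ℕ // p.Prime},
        ((p : ℝ) - 1) / ∏ q ∈ (Finset.range (p : ℕ)).filter Nat.Prime, (q : ℝ))) := by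
  simp_rw [sum_smallestNonDivisorPrime_eq_tsum, ← tsum_div_const]
  refine tendsto_tsum_of_dominated_convergence summable_div_prod_primes_below
    (fun p => ?_) (Filter.Eventually.of_forall fun N p => ?_)
  · have hp : ((p : ℕ) : ℝ) ≠ 0 := by exact_mod_cast p.2.ne_zero
    have hM : ((∏ q ∈ (Finset.range (p : ℕ)).filter Nat.Prime, q : ℕ) : ℝ) ≠ 0 := by
      exact_mod_cast (prod_primes_below_pos p).ne'
    rw [← Nat.cast_prod]
    have hlim := ((tendsto_natDiv_div_atTop
      (∏ q ∈ (Finset.range (p : ℕ)).filter Nat.Prime, q)).sub (tendsto_natDiv_div_atTop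
      ((∏ q ∈ (Finset.range (p : ℕ)).filter Nat.Prime, q) * p))).mul_const ((p : ℕ) : ℝ)
    convert hlim using 2 with N
    · rw [card_smallestNonDivisorPrime_eq N p.2]
      ring
    · rw [Nat.cast_mul]
      field_simp
  · rw [Real.norm_of_nonneg (by positivity), card_smallestNonDivisorPrime_eq N p.2]
    set M := ∏ q ∈ (Finset.range (p : ℕ)).filter Nat.Prime, q
    rcases Nat.eq_zero_or_pos N with rfl | hN
    · simp only [Nat.cast_zero, div_zero]
      positivity
    have hN' : (0 : ℝ) < N := by exact_mod_cast hN
    rw [div_le_iff₀ hN']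
    calc (((N / M : ℕ) : ℝ) - ((N / (M * p) : ℕ) : ℝ)) * ((p : ℕ) : ℝ)
        ≤ ((N : ℝ) / M) * ((p : ℕ) : ℝ) := by
          gcongr
          exact (sub_le_self _ (Nat.cast_nonneg _)).trans Nat.cast_div_le
      _ = ((p : ℕ) : ℝ) / M * N := by ring
end

section
/- Let F₂ be the free group on two generators a, b. For each prime p, let φ_p : F₂ → SL(2, ℤ/pℤ) be the homomorphism sending a to the matrix [[1,2],[0,1]] and b to the matrix [[1,0],[2,1]] (entries reduced mod p). Then there exists a constant c > 0 such that for every nontrivial w ∈ F₂ of word length n there is a prime p ≤ c·n with φ_p(w) ≠ 1. -/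
/-- The matrix `[[1,2],[0,1]]` as an element of `SL(2, ℤ/pℤ)`. -/
def sl2ZModGenA (p : ℕ) : Matrix.SpecialLinearGroup (Fin 2) (ZMod p) :=
  ⟨!![1, 2; 0, 1], by simp [Matrix.det_fin_two_of]⟩

/-- The matrix `[[1,0],[2,1]]` as an element of `SL(2, ℤ/pℤ)`. -/
def sl2ZModGenB (p : ℕ) : Matrix.SpecialLinearGroup (Fin 2) (ZMod p) :=
  ⟨!![1, 0; 2, 1], by simp [Matrix.det_fin_two_of]⟩

/-- The homomorphism `F₂ → SL(2, ℤ/pℤ)` sending the generators to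
`[[1,2],[0,1]]` and `[[1,0],[2,1]]`. -/
def sl2ZModRep (p : ℕ) : FreeGroup (Fin 2) →* Matrix.SpecialLinearGroup (Fin 2) (ZMod p) :=
  FreeGroup.lift ![sl2ZModGenA p, sl2ZModGenB p]

open Matrix in
/-- The homomorphism `F₂ → SL(2, ℤ)` sending the generators to
`[[1,2],[0,1]]` and `[[1,0],[2,1]]`. -/
def sl2IntRep : FreeGroup (Fin 2) →* SpecialLinearGroup (Fin 2) ℤ :=
  FreeGroup.lift ![⟨!![1, 2; 0, 1], by simp [det_fin_two_of]⟩,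
    ⟨!![1, 0; 2, 1], by simp [det_fin_two_of]⟩]

theorem sl2ZModRep_eq_map_sl2IntRep (p : ℕ) (w : FreeGroup (Fin 2)) :
    sl2ZModRep p w =
      Matrix.SpecialLinearGroup.map (Int.castRingHom (ZMod p)) (sl2IntRep w) := by
  have h : sl2ZModRep p =
      (Matrix.SpecialLinearGroup.map (Int.castRingHom (ZMod p))).comp sl2IntRep := by
    ext x i j
    change _ = ((sl2IntRep (FreeGroup.of x) i j : ℤ) : ZMod p)
    fin_cases x <;> fin_cases i <;> fin_cases j <;>
      simp [sl2ZModRep, sl2IntRep, sl2ZModGenA, sl2ZModGenB]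
  rw [h, MonoidHom.comp_apply]

theorem sl2IntRep_mk_cons (x : Fin 2 × Bool) (L : List (Fin 2 × Bool)) :
    sl2IntRep (FreeGroup.mk (x :: L)) =
      sl2IntRep (FreeGroup.mk [x]) * sl2IntRep (FreeGroup.mk L) := by
  rw [← map_mul, FreeGroup.mul_mk, List.singleton_append]

theorem sl2IntRep_mk_zero_singleton (b : Bool) :
    (sl2IntRep (FreeGroup.mk [(0, b)])).1 = !![1, 2 * cond b 1 (-1); 0, 1] := by
  ext i j
  cases b <;> fin_cases i <;> fin_cases j <;> rfl

theorem sl2IntRep_mk_one_singleton (b : Bool) :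
    (sl2IntRep (FreeGroup.mk [(1, b)])).1 = !![1, 0; 2 * cond b 1 (-1), 1] := by
  ext i j
  cases b <;> fin_cases i <;> fin_cases j <;> rfl

theorem sl2IntRep_mk_zero_cons (b : Bool) (L : List (Fin 2 × Bool)) (j : Fin 2) :
    sl2IntRep (FreeGroup.mk ((0, b) :: L)) 0 j = sl2IntRep (FreeGroup.mk L) 0 j +
        2 * cond b 1 (-1) * sl2IntRep (FreeGroup.mk L) 1 j ∧
      sl2IntRep (FreeGroup.mk ((0, b) :: L)) 1 j = sl2IntRep (FreeGroup.mk L) 1 j := by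
  rw [sl2IntRep_mk_cons, Matrix.SpecialLinearGroup.coe_mul, sl2IntRep_mk_zero_singleton]
  simp [Matrix.mul_apply, Fin.sum_univ_two]

theorem sl2IntRep_mk_one_cons (b : Bool) (L : List (Fin 2 × Bool)) (j : Fin 2) :
    sl2IntRep (FreeGroup.mk ((1, b) :: L)) 0 j = sl2IntRep (FreeGroup.mk L) 0 j ∧
      sl2IntRep (FreeGroup.mk ((1, b) :: L)) 1 j = sl2IntRep (FreeGroup.mk L) 1 j +
        2 * cond b 1 (-1) * sl2IntRep (FreeGroup.mk L) 0 j := by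
  rw [sl2IntRep_mk_cons, Matrix.SpecialLinearGroup.coe_mul, sl2IntRep_mk_one_singleton]
  simp [Matrix.mul_apply, Fin.sum_univ_two, add_comm]

theorem abs_sl2IntRep_mk_apply_le (L : List (Fin 2 × Bool)) (i j : Fin 2) :
    |sl2IntRep (FreeGroup.mk L) i j| ≤ 3 ^ L.length := by
  induction L generalizing i j with
  | nil =>
    rw [← FreeGroup.one_eq_mk, map_one]
    fin_cases i <;> fin_cases j <;> simp
  | cons x L ih =>
    obtain ⟨k, b⟩ := x
    have h₀ := abs_le.mp (ih 0 j)
    have h₁ := abs_le.mp (ih 1 j)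
    rw [List.length_cons, pow_succ, abs_le]
    fin_cases k
    · obtain ⟨e₀, e₁⟩ := sl2IntRep_mk_zero_cons b L j
      cases b <;> fin_cases i <;> simp_all <;> constructor <;> linarith
    · obtain ⟨e₀, e₁⟩ := sl2IntRep_mk_one_cons b L j
      cases b <;> fin_cases i <;> simp_all <;> constructor <;> linarith

/-- If `[[p,q],[q,r]]` is positive definite of determinant one and `p < |q|`, then `|q| < r`. -/
theorem abs_lt_of_lt_abs_of_mul_sub_sq_eq_one {p q r : ℤ} (hp : 0 < p)
    (h : p * r - q ^ 2 = 1) (hq : p < |q|) : |q| < r := by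
  by_contra! hr
  nlinarith [sq_abs q, abs_nonneg q]

/-- In the Gram matrix `[[p,q],[q,r]]` of the rows of the image of a reduced word, the first
letter of the word determines the sign of `q` and which diagonal entry is below `|q|`. -/
theorem sl2IntRep_gram_ping_pong (L : List (Fin 2 × Bool)) (hL : FreeGroup.IsReduced L) :
    let M := sl2IntRep (FreeGroup.mk L)
    let p := M 0 0 ^ 2 + M 0 1 ^ 2
    let q := M 0 0 * M 1 0 + M 0 1 * M 1 1
    let r := M 1 0 ^ 2 + M 1 1 ^ 2
    ∀ x ∈ L.head?, (x.1 = 0 → r < cond x.2 1 (-1) * q) ∧ (x.1 = 1 → p < cond x.2 1 (-1) * q) := by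
  induction L with
  | nil => simp
  | cons x L ih =>
    intro M p q r y hy
    obtain rfl : x = y := by simpa using hy
    have ih := ih (hL.infix (List.suffix_cons x L).isInfix)
    have hhead : ∀ y ∈ L.head?, x.1 = y.1 → x.2 = y.2 := by
      cases L with
      | nil => simp
      | cons y L => simpa using (FreeGroup.isReduced_cons_cons.mp hL).1
    have hnil : L = [] → sl2IntRep (FreeGroup.mk L) = 1 := by
      rintro rfl
      rw [← FreeGroup.one_eq_mk, map_one]
    obtain ⟨k, b⟩ := x
    have hdet := (sl2IntRep (FreeGroup.mk L)).2
    rw [Matrix.det_fin_two] at hdet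
    set N := sl2IntRep (FreeGroup.mk L) with hN
    dsimp only at ih
    set p' := N 0 0 ^ 2 + N 0 1 ^ 2 with hp'
    set q' := N 0 0 * N 1 0 + N 0 1 * N 1 1 with hq'
    set r' := N 1 0 ^ 2 + N 1 1 ^ 2 with hr'
    have hgram : p' * r' - q' ^ 2 = 1 := by
      rw [hp', hq', hr']
      linear_combination (N.1 0 0 * N.1 1 1 - N.1 0 1 * N.1 1 0 + 1) * hdet
    have hp0 : 0 < p' := by
      have : 0 ≤ p' := by positivity
      rcases this.eq_or_lt with h | h
      · rw [← h] at hgram; nlinarith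
      · exact h
    have hr0 : 0 < r' := by
      have : 0 ≤ r' := by positivity
      rcases this.eq_or_lt with h | h
      · rw [← h] at hgram; nlinarith
      · exact h
    have hq0 : L = [] → q' = 0 := by
      intro h
      rw [hq', hnil h]
      simp
    have h_abs (c : Bool) : cond c 1 (-1) * q' ≤ |q'| ∧ -|q'| ≤ cond c 1 (-1) * q' := by
      cases c <;> simp [neg_abs_le, le_abs_self, neg_le_abs]
    have h_sq : (cond b 1 (-1) : ℤ) * cond b 1 (-1) = 1 := by cases b <;> rfl
    have h_zero : k = 0 → -r' < cond b 1 (-1) * q' := by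
      rintro rfl
      rcases L with _ | ⟨⟨l, c⟩, L⟩
      · simp [hq0 rfl, hr0]
      · have ih := ih (l, c) (by simp)
        have hc := hhead (l, c) (by simp)
        obtain rfl | rfl : l = 0 ∨ l = 1 := by omega
        · rw [show b = c from hc rfl]
          linarith [ih.1 rfl]
        · have := abs_lt_of_lt_abs_of_mul_sub_sq_eq_one hp0 hgram ((ih.2 rfl).trans_le (h_abs c).1)
          linarith [(h_abs b).2]
    have h_one : k = 1 → -p' < cond b 1 (-1) * q' := by
      rintro rfl
      rcases L with _ | ⟨⟨l, c⟩, L⟩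
      · simp [hq0 rfl, hp0]
      · have ih := ih (l, c) (by simp)
        have hc := hhead (l, c) (by simp)
        obtain rfl | rfl : l = 0 ∨ l = 1 := by omega
        · have := abs_lt_of_lt_abs_of_mul_sub_sq_eq_one hr0 (by rwa [mul_comm])
            ((ih.1 rfl).trans_le (h_abs c).1)
          linarith [(h_abs b).2]
        · rw [show b = c from hc rfl]
          linarith [ih.2 rfl]
    refine ⟨?_, ?_⟩
    · rintro rfl
      have hr : r = r' := by
        simp only [r, M, sl2IntRep_mk_zero_cons]
        rfl
      have hq : q = q' + 2 * cond b 1 (-1) * r' := by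
        simp only [q, M, sl2IntRep_mk_zero_cons, hq', hr', hN]
        ring
      rw [hr, hq]
      linear_combination h_zero rfl - 2 * r' * h_sq
    · rintro rfl
      have hp : p = p' := by
        simp only [p, M, sl2IntRep_mk_one_cons]
        rfl
      have hq : q = q' + 2 * cond b 1 (-1) * p' := by
        simp only [q, M, sl2IntRep_mk_one_cons, hq', hp', hN]
        ring
      rw [hp, hq]
      linear_combination h_one rfl - 2 * p' * h_sq

theorem sl2IntRep_injective : Function.Injective sl2IntRep := by
  rw [injective_iff_map_eq_one]
  intro w hw
  by_contra h
  obtain ⟨x, L, hx⟩ := List.exists_cons_of_ne_nil (mt FreeGroup.toWord_eq_nil_iff.mp h)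
  have key := sl2IntRep_gram_ping_pong w.toWord FreeGroup.isReduced_toWord x (by simp [hx])
  rw [FreeGroup.mk_toWord, hw] at key
  obtain ⟨k, b⟩ := x
  fin_cases k <;> simp at key

open Filter Asymptotics Chebyshev in
theorem eventually_half_mul_le_theta : ∀ᶠ n : ℕ in atTop, (n : ℝ) / 2 ≤ θ n := by
  have h₁ := (isLittleO_log_rpow_atTop (show (0 : ℝ) < 1 / 2 by norm_num)).bound
    (show (0 : ℝ) < 1 / 100 by norm_num)
  have h₂ := Real.isLittleO_log_id_atTop.bound (show (0 : ℝ) < 1 / 100 by norm_num)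
  filter_upwards [tendsto_natCast_atTop_atTop.eventually h₁,
    tendsto_natCast_atTop_atTop.eventually h₂, eventually_ge_atTop 100] with n h₁ h₂ hn
  have hn' : (100 : ℝ) ≤ n := by exact_mod_cast hn
  have hlog : 0 ≤ Real.log n := Real.log_nonneg (by linarith)
  rw [← Real.sqrt_eq_rpow, Real.norm_of_nonneg hlog, Real.norm_of_nonneg (Real.sqrt_nonneg _)] at h₁
  rw [Real.norm_of_nonneg hlog, id, Real.norm_of_nonneg (by linarith)] at h₂
  have h₃ : Real.log (n + 1) ≤ Real.log 2 + Real.log n := by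
    rw [← Real.log_mul (by norm_num) (by linarith)]
    exact Real.log_le_log (by linarith) (by linarith)
  have h₄ : √(n : ℝ) * Real.log n ≤ n / 100 := by
    nlinarith [Real.sq_sqrt (show (0 : ℝ) ≤ n by linarith), Real.sqrt_nonneg (n : ℝ)]
  nlinarith [theta_ge n, Real.log_two_gt_d9, Real.log_two_lt_d9]

theorem exists_four_pow_lt_primorial_mul :
    ∃ C : ℕ, 0 < C ∧ ∀ n : ℕ, n ≠ 0 → 4 ^ n < primorial (C * n) := by
  obtain ⟨N, hN⟩ := Filter.eventually_atTop.mp eventually_half_mul_le_theta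
  refine ⟨N + 3, by omega, fun n hn => ?_⟩
  have hn' : (1 : ℝ) ≤ n := by exact_mod_cast Nat.one_le_iff_ne_zero.mpr hn
  have h := hN ((N + 3) * n) (by nlinarith [Nat.pos_of_ne_zero hn])
  rw [Chebyshev.theta_eq_log_primorial, Nat.floor_natCast] at h
  have h₄ : Real.log 4 = 2 * Real.log 2 := by
    rw [show (4 : ℝ) = 2 ^ 2 by norm_num, Real.log_pow]; norm_num
  have : Real.log ((4 : ℝ) ^ n) < Real.log (primorial ((N + 3) * n)) := by
    rw [Real.log_pow, h₄]
    push_cast at h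
    nlinarith [Real.log_two_lt_d9, (Nat.cast_nonneg N : (0 : ℝ) ≤ N)]
  exact_mod_cast (Real.log_lt_log_iff (by positivity) (by exact_mod_cast primorial_pos _)).mp this

theorem Int.eq_zero_of_abs_lt_primorial {m : ℕ} {a : ℤ} (ha : |a| < primorial m)
    (h : ∀ p : ℕ, p.Prime → p ≤ m → (p : ℤ) ∣ a) : a = 0 := by
  refine Int.eq_zero_of_abs_lt_dvd (m := primorial m) ?_ ha
  rw [Int.natCast_dvd]
  refine Finset.prod_primes_dvd _ (fun p hp => (Finset.mem_filter.mp hp).2.prime) fun p hp => ?_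
  simp only [Finset.mem_filter, Finset.mem_range] at hp
  exact Int.natCast_dvd.mp (h p hp.2 (by omega))

/-- **Cubic residual finiteness of `F₂`, congruence form.**
There is a constant `c > 0` so that every nontrivial word `w` of length `n` in `F₂`
survives in `SL(2, ℤ/pℤ)` for some prime `p ≤ c·n`. -/
theorem exists_prime_le_linear_sl2_rep_ne_one :
    ∃ c : ℝ, 0 < c ∧
      ∀ w : FreeGroup (Fin 2), w ≠ 1 →
        ∃ p : ℕ, p.Prime ∧ (p : ℝ) ≤ c * (FreeGroup.norm w : ℝ) ∧ sl2ZModRep p w ≠ 1 := by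
  obtain ⟨C, hC, hlt⟩ := exists_four_pow_lt_primorial_mul
  refine ⟨C, by exact_mod_cast hC, fun w hw => ?_⟩
  by_contra! hall
  refine hw (sl2IntRep_injective ?_)
  rw [map_one]
  ext i j
  rw [← sub_eq_zero]
  have hn : w.norm ≠ 0 := mt FreeGroup.norm_eq_zero.mp hw
  refine Int.eq_zero_of_abs_lt_primorial (m := C * w.norm) ?_ fun p hp hpm => ?_
  · have h₁ := abs_sl2IntRep_mk_apply_le w.toWord i j
    rw [FreeGroup.mk_toWord] at h₁
    have h₂ : |(1 : Matrix.SpecialLinearGroup (Fin 2) ℤ) i j| ≤ 1 := by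
      fin_cases i <;> fin_cases j <;> simp
    have h₃ : (3 : ℤ) ^ w.norm + 1 ≤ 4 ^ w.norm := by
      exact_mod_cast Nat.pow_lt_pow_left (by norm_num : 3 < 4) hn
    have h₄ : (4 : ℤ) ^ w.norm < primorial (C * w.norm) := by exact_mod_cast hlt _ hn
    calc _ ≤ _ := abs_sub _ _
      _ ≤ 3 ^ w.norm + 1 := add_le_add h₁ h₂
      _ < _ := by linarith
  · have h := hall p hp (by exact_mod_cast hpm)
    rw [sl2ZModRep_eq_map_sl2IntRep] at h
    have hij := congr_fun₂ (congr_arg Subtype.val h) i j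
    rw [← ZMod.intCast_zmod_eq_zero_iff_dvd, Int.cast_sub, sub_eq_zero]
    fin_cases i <;> fin_cases j <;> simpa using hij
end

section
/- Fix integers n ≥ 1 and k ≥ 1, and let m₁, …, m_k be n×n real matrices that are upper triangular with all diagonal entries equal to 1. Then there exists a constant C > 0 such that for every integer m ≥ 1 and every product M of m factors, each factor being some m_i or some m_i⁻¹, every entry of M satisfies |M_{ij}| ≤ C·m^(n−1). -/
/-- The inverse of a unipotent upper triangular matrix is unipotent upper triangular. -/
theorem Matrix.BlockTriangular.inv_unipotent {n : ℕ} {M : Matrix (Fin n) (Fin n) ℝ}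
    (hM : M.BlockTriangular id) (hd : ∀ l, M l l = 1) :
    M⁻¹.BlockTriangular id ∧ ∀ l, M⁻¹ l l = 1 := by
  have hdet : IsUnit M.det := by
    rw [Matrix.det_of_isUpperTriangular hM]
    simp [hd]
  let := M.invertibleOfIsUnitDet hdet
  have hI : M⁻¹.BlockTriangular id := Matrix.blockTriangular_inv_of_blockTriangular hM
  refine ⟨hI, fun l => ?_⟩
  have h := congrFun (congrFun (Matrix.mul_nonsing_inv M hdet) l) l
  rw [Matrix.mul_apply, Finset.sum_eq_single l, hd, one_mul, Matrix.one_apply_eq] at h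
  · exact h
  · intro t _ ht
    rcases lt_or_gt_of_ne ht with h1 | h1
    · rw [hM (show id t < id l from h1), zero_mul]
    · rw [hI (show id l < id t from h1), mul_zero]
  · simp

/-- A product of unipotent upper triangular matrices with entries bounded by `K` has entries in
row `r` that grow polynomially of degree at most `n - 1 - r` in the number of factors. -/
theorem abs_list_prod_unipotent_le {n : ℕ} {K c : ℝ} (hK : 0 ≤ K) (hc : 1 ≤ c) (hKc : n * K ≤ c)
    (L : List (Matrix (Fin n) (Fin n) ℝ))
    (hL : ∀ X ∈ L, X.BlockTriangular id ∧ (∀ l, X l l = 1) ∧ ∀ r s, |X r s| ≤ K) (r s : Fin n) :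
    |L.prod r s| ≤ (c * (L.length + 1)) ^ (n - 1 - (r : ℕ)) := by
  induction L generalizing r s with
  | nil =>
    have h1 : |(1 : Matrix (Fin n) (Fin n) ℝ) r s| ≤ 1 := by
      rw [Matrix.one_apply]; split_ifs <;> simp
    simpa using h1.trans (one_le_pow₀ hc)
  | cons X L ih =>
    obtain ⟨htri, hdiag, hent⟩ := hL X (by simp)
    replace ih := ih fun Y hY => hL Y (by simp [hY])
    rw [List.prod_cons, Matrix.mul_apply, ← Finset.add_sum_erase _ _ (Finset.mem_univ r), hdiag,
      one_mul, List.length_cons]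
    push_cast
    set x : ℝ := (L.length : ℝ) + 1 with hx
    have hx1 : 1 ≤ x := by simp [hx]
    have hcx : 1 ≤ c * x := one_le_mul_of_one_le_of_one_le hc hx1
    obtain hd | ⟨d, hd⟩ : n - 1 - (r : ℕ) = 0 ∨ ∃ d, n - 1 - (r : ℕ) = d + 1 := by
      cases n - 1 - (r : ℕ) <;> simp
    · have hzero : ∑ t ∈ Finset.univ.erase r, X r t * L.prod t s = 0 := by
        refine Finset.sum_eq_zero fun t ht => ?_
        have hne : (t : ℕ) ≠ r := fun h => Finset.ne_of_mem_erase ht (Fin.ext h)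
        have hlt : t < r := by rw [Fin.lt_def]; omega
        rw [htri (show id t < id r from hlt), zero_mul]
      have := ih r s
      rw [hd] at this ⊢
      simpa [hzero] using this
    · have hterm : ∀ t ∈ Finset.univ.erase r, |X r t * L.prod t s| ≤ K * (c * x) ^ d := by
        intro t ht
        have hne : (t : ℕ) ≠ r := fun h => Finset.ne_of_mem_erase ht (Fin.ext h)
        rcases lt_or_ge t r with hlt | hge
        · rw [htri (show id t < id r from hlt), zero_mul, abs_zero]
          positivity
        · rw [abs_mul]
          refine mul_le_mul (hent r t) ((ih t s).trans ?_) (abs_nonneg _) hK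
          refine pow_le_pow_right₀ hcx ?_
          rw [Fin.le_def] at hge
          omega
      have hsum : |∑ t ∈ Finset.univ.erase r, X r t * L.prod t s| ≤ c * (c * x) ^ d := by
        calc _ ≤ ∑ t ∈ Finset.univ.erase r, |X r t * L.prod t s| := Finset.abs_sum_le_sum_abs _ _
          _ ≤ ∑ _t ∈ Finset.univ.erase r, K * (c * x) ^ d := Finset.sum_le_sum hterm
          _ ≤ ∑ _t : Fin n, K * (c * x) ^ d :=
            Finset.sum_le_sum_of_subset_of_nonneg (Finset.erase_subset _ _)
              fun _ _ _ => by positivity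
          _ = n * K * (c * x) ^ d := by simp [mul_assoc]
          _ ≤ c * (c * x) ^ d := by gcongr
      have hih := ih r s
      rw [hd] at hih ⊢
      calc _ ≤ (c * x) ^ (d + 1) + c * (c * x) ^ d :=
            (abs_add_le _ _).trans (add_le_add hih hsum)
        _ = (c * x) ^ d * (c * (x + 1)) := by ring
        _ ≤ (c * (x + 1)) ^ d * (c * (x + 1)) := by gcongr; linarith
        _ = (c * (x + 1)) ^ (d + 1) := by ring


/-- **Polynomial entry growth of words in unipotent matrices.**
If `m₁, …, m_k` are `n×n` unipotent upper triangular real matrices, then there is `C > 0`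
such that every product `M` of `m` factors, each an `m_i` or an `m_i⁻¹`, has all entries
bounded in absolute value by `C·m^(n−1)`. -/
theorem entries_of_unipotent_word_le
    (n k : ℕ) (hn : 1 ≤ n) (hk : 1 ≤ k)
    (A : Fin k → Matrix (Fin n) (Fin n) ℝ)
    (htri : ∀ i, (A i).BlockTriangular id)
    (hdiag : ∀ i, ∀ l : Fin n, A i l l = 1) :
    ∃ C : ℝ, 0 < C ∧
      ∀ (m : ℕ), 1 ≤ m →
        ∀ L : List (Matrix (Fin n) (Fin n) ℝ), L.length = m →
          (∀ X ∈ L, ∃ i, X = A i ∨ X = (A i)⁻¹) →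
          ∀ r s : Fin n, |L.prod r s| ≤ C * (m : ℝ) ^ (n - 1) := by
  obtain ⟨K, hK⟩ : ∃ K : ℝ, ∀ p : Fin k × Fin n × Fin n,
      |A p.1 p.2.1 p.2.2| ≤ K ∧ |(A p.1)⁻¹ p.2.1 p.2.2| ≤ K := by
    obtain ⟨K, hK⟩ := (Set.finite_range fun p : Fin k × Fin n × Fin n =>
      max |A p.1 p.2.1 p.2.2| |(A p.1)⁻¹ p.2.1 p.2.2|).bddAbove
    exact ⟨K, fun p => max_le_iff.mp (hK ⟨p, rfl⟩)⟩
  have hK0 : 0 ≤ K := (abs_nonneg _).trans (hK (⟨0, hk⟩, ⟨0, hn⟩, ⟨0, hn⟩)).1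
  set c : ℝ := n * K + 1 with hc
  have hc1 : 1 ≤ c := by rw [hc]; linarith [mul_nonneg (Nat.cast_nonneg (α := ℝ) n) hK0]
  refine ⟨(2 * c) ^ (n - 1), by positivity, fun m hm L hLm hL r s => ?_⟩
  have hm1 : (1 : ℝ) ≤ m := by exact_mod_cast hm
  have hbound := abs_list_prod_unipotent_le hK0 hc1 (by linarith) L (fun X hX => by
    obtain ⟨i, rfl | rfl⟩ := hL X hX
    · exact ⟨htri i, hdiag i, fun r s => (hK (i, r, s)).1⟩
    · obtain ⟨h1, h2⟩ := (htri i).inv_unipotent (hdiag i)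
      exact ⟨h1, h2, fun r s => (hK (i, r, s)).2⟩) r s
  rw [hLm] at hbound
  calc _ ≤ (c * (m + 1)) ^ (n - 1 - (r : ℕ)) := hbound
    _ ≤ (c * (m + 1)) ^ (n - 1) :=
      pow_le_pow_right₀ (one_le_mul_of_one_le_of_one_le hc1 (by linarith)) (Nat.sub_le _ _)
    _ ≤ (c * (2 * m)) ^ (n - 1) := by gcongr; linarith
    _ = (2 * c) ^ (n - 1) * (m : ℝ) ^ (n - 1) := by rw [← mul_pow]; ring
end
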